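/- arXiv:1901.07671 — 2 statements merged into one kernel-verified Lean document; each statement's English description precedes it below -/
import Mathlib

section
/- Let n ≤ 3 and let u be a non-constant solution of the Allen–Cahn equation −Δu = u − u³ on ℝⁿ. Suppose that the zero level set {x ∈ ℝⁿ : u(x) = 0} is contained in the open half-space {x ∈ ℝⁿ : xₙ > 0}. Then u is one-dimensional: there exists a real number a such that either u(x) = H(−xₙ + a) for all x ∈ ℝⁿ, or u(x) = H(xₙ + a) for all x ∈ ℝⁿ. -/
noncomputable def laplacian {n : ℕ} (u : EuclideanSpace ℝ (Fin n) → ℝ)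
    (x : EuclideanSpace ℝ (Fin n)) : ℝ :=
  ∑ i : Fin n, fderiv ℝ (fun y => fderiv ℝ u y (EuclideanSpace.single i 1)) x
    (EuclideanSpace.single i 1)

def IsACSolution {n : ℕ} (u : EuclideanSpace ℝ (Fin n) → ℝ) : Prop :=
  ContDiff ℝ 2 u ∧ ∀ x, -laplacian u x = u x - (u x) ^ 3

noncomputable def H (t : ℝ) : ℝ := Real.tanh (t / Real.sqrt 2)

open Filter Topology

/-- Second order expansion data of a function of one variable at a point. -/
def J2 (φ : ℝ → ℝ) (x a b : ℝ) : Prop :=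
  ∃ φ' : ℝ → ℝ, (∀ᶠ t in 𝓝 x, HasDerivAt φ (φ' t) t) ∧ φ' x = a ∧ HasDerivAt φ' b x

lemma J2.of {φ φ' : ℝ → ℝ} {x b : ℝ} (h : ∀ t, HasDerivAt φ (φ' t) t)
    (h2 : HasDerivAt φ' b x) : J2 φ x (φ' x) b :=
  ⟨φ', Eventually.of_forall h, rfl, h2⟩

lemma J2.const (c x : ℝ) : J2 (fun _ => c) x 0 0 :=
  ⟨fun _ => 0, Eventually.of_forall fun t => hasDerivAt_const t c, rfl, hasDerivAt_const x 0⟩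

lemma J2.add {φ ψ : ℝ → ℝ} {x a b c d : ℝ} (h : J2 φ x a b) (k : J2 ψ x c d) :
    J2 (fun t => φ t + ψ t) x (a + c) (b + d) := by
  obtain ⟨f, hf, rfl, hf2⟩ := h
  obtain ⟨g, hg, rfl, hg2⟩ := k
  refine ⟨fun t => f t + g t, ?_, rfl, hf2.add hg2⟩
  filter_upwards [hf, hg] with t h1 h2 using h1.add h2

lemma J2.mul {φ ψ : ℝ → ℝ} {x a b c d : ℝ} (h : J2 φ x a b) (k : J2 ψ x c d) :
    J2 (fun t => φ t * ψ t) x (a * ψ x + φ x * c) (b * ψ x + 2 * a * c + φ x * d) := by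
  obtain ⟨f, hf, rfl, hf2⟩ := h
  obtain ⟨g, hg, rfl, hg2⟩ := k
  refine ⟨fun t => f t * ψ t + φ t * g t, ?_, rfl, ?_⟩
  · filter_upwards [hf, hg] with t h1 h2 using h1.mul h2
  · have := (hf2.mul hg.self_of_nhds).add (hf.self_of_nhds.mul hg2)
    refine this.congr_deriv ?_
    ring

lemma J2.constMul {φ : ℝ → ℝ} {x a b : ℝ} (r : ℝ) (h : J2 φ x a b) :
    J2 (fun t => r * φ t) x (r * a) (r * b) := by
  have := (J2.const r x).mul h
  simpa using this

lemma J2.comp {φ G G' : ℝ → ℝ} {x a b g2 : ℝ} (h : J2 φ x a b)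
    (hG : ∀ᶠ s in 𝓝 (φ x), HasDerivAt G (G' s) s) (hG2 : HasDerivAt G' g2 (φ x)) :
    J2 (fun t => G (φ t)) x (G' (φ x) * a) (g2 * a ^ 2 + G' (φ x) * b) := by
  obtain ⟨f, hf, rfl, hf2⟩ := h
  have hc : ContinuousAt φ x := hf.self_of_nhds.continuousAt
  refine ⟨fun t => G' (φ t) * f t, ?_, rfl, ?_⟩
  · filter_upwards [hf, hc.eventually hG] with t h1 h2 using h2.comp t h1
  · have := (hG2.comp x hf.self_of_nhds).mul hf2
    refine this.congr_deriv ?_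
    simp only [Function.comp_apply]
    ring

lemma J2.max {φ : ℝ → ℝ} {x a b : ℝ} (h : J2 φ x a b) (hm : IsLocalMax φ x) :
    a = 0 ∧ b ≤ 0 := by
  obtain ⟨f, hf, rfl, hf2⟩ := h
  have h0 : f x = 0 := hm.hasDerivAt_eq_zero hf.self_of_nhds
  refine ⟨h0, ?_⟩
  by_contra hb
  push Not at hb
  have he : deriv φ =ᶠ[𝓝 x] f := by
    filter_upwards [hf] with t ht using ht.deriv
  have h2 : deriv (deriv φ) x = b := by
    rw [he.deriv_eq]; exact hf2.deriv
  have hmin : IsLocalMin φ x :=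
    isLocalMin_of_deriv_deriv_pos (by rw [h2]; exact hb) (by rw [hf.self_of_nhds.deriv, h0])
      hf.self_of_nhds.continuousAt
  have hc : φ =ᶠ[𝓝 x] fun _ => φ x := by
    filter_upwards [hm, hmin] with t h1 h2 using le_antisymm h1 h2
  have hd : deriv φ =ᶠ[𝓝 x] fun _ => 0 := by
    have := hc.deriv
    simpa using this
  have : deriv (deriv φ) x = 0 := by rw [hd.deriv_eq]; simp
  linarith

lemma max3 {F : ℝ × ℝ × ℝ → ℝ} {x y z a1 b1 a2 b2 a3 b3 : ℝ}
    (hm : IsLocalMax F (x, y, z))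
    (h1 : J2 (fun t => F (t, y, z)) x a1 b1) (h2 : J2 (fun t => F (x, t, z)) y a2 b2)
    (h3 : J2 (fun t => F (x, y, t)) z a3 b3) :
    a1 = 0 ∧ a2 = 0 ∧ a3 = 0 ∧ b1 + b2 + b3 ≤ 0 := by
  have k1 : IsLocalMax (fun t => F (t, y, z)) x := by
    have : ContinuousAt (fun t : ℝ => (t, y, z)) x := by fun_prop
    exact this.eventually hm
  have k2 : IsLocalMax (fun t => F (x, t, z)) y := by
    have : ContinuousAt (fun t : ℝ => (x, t, z)) y := by fun_prop
    exact this.eventually hm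
  have k3 : IsLocalMax (fun t => F (x, y, t)) z := by
    have : ContinuousAt (fun t : ℝ => (x, y, t)) z := by fun_prop
    exact this.eventually hm
  obtain ⟨e1, f1⟩ := h1.max k1
  obtain ⟨e2, f2⟩ := h2.max k2
  obtain ⟨e3, f3⟩ := h3.max k3
  exact ⟨e1, e2, e3, by linarith⟩

lemma exists_max_on {F : ℝ × ℝ × ℝ → ℝ} {C : Set (ℝ × ℝ × ℝ)} (hC : IsClosed C)
    (hF : ContinuousOn F C) {R : ℝ}
    (hb : ∀ x y z, (x, y, z) ∈ C → 0 < F (x, y, z) → |x| ≤ R ∧ |y| ≤ R ∧ |z| ≤ R)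
    {p0 : ℝ × ℝ × ℝ} (hp0 : p0 ∈ C) (hpos : 0 < F p0) :
    ∃ x y z, (x, y, z) ∈ C ∧ 0 < F (x, y, z) ∧ ∀ q ∈ C, F q ≤ F (x, y, z) := by
  have hin : ∀ q ∈ C, 0 < F q → q ∈ Metric.closedBall (0 : ℝ × ℝ × ℝ) R := by
    rintro ⟨x, y, z⟩ hq hq2
    obtain ⟨h1, h2, h3⟩ := hb x y z hq hq2
    simp [Metric.mem_closedBall, h1, h2, h3]
  have hK : IsCompact (C ∩ Metric.closedBall (0 : ℝ × ℝ × ℝ) R) :=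
    (isCompact_closedBall _ _).inter_left hC
  obtain ⟨⟨x, y, z⟩, hp, hmax⟩ := hK.exists_isMaxOn ⟨p0, hp0, hin p0 hp0 hpos⟩
    (hF.mono Set.inter_subset_left)
  have hpp : 0 < F (x, y, z) := lt_of_lt_of_le hpos (hmax ⟨hp0, hin p0 hp0 hpos⟩)
  refine ⟨x, y, z, hp.1, hpp, fun q hq => ?_⟩
  by_cases h : 0 < F q
  · exact hmax ⟨hq, hin q hq h⟩
  · push Not at h; linarith

/-- `U` is a solution of the Allen-Cahn equation in three variables, line-wise sense. -/
structure Sol (U : ℝ × ℝ × ℝ → ℝ) : Prop where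
  cont : Continuous U
  pde : ∀ x y z, ∃ a1 b1 a2 b2 a3 b3, J2 (fun t => U (t, y, z)) x a1 b1 ∧
    J2 (fun t => U (x, t, z)) y a2 b2 ∧ J2 (fun t => U (x, y, t)) z a3 b3 ∧
    b1 + b2 + b3 = U (x, y, z) ^ 3 - U (x, y, z)

lemma Sol.neg {U : ℝ × ℝ × ℝ → ℝ} (h : Sol U) : Sol (fun p => - U p) := by
  refine ⟨h.cont.neg, fun x y z => ?_⟩
  obtain ⟨a1, b1, a2, b2, a3, b3, h1, h2, h3, he⟩ := h.pde x y z
  refine ⟨_, _, _, _, _, _, by simpa using h1.constMul (-1), by simpa using h2.constMul (-1),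
    by simpa using h3.constMul (-1), ?_⟩
  linear_combination -he

lemma J2.sq (x c : ℝ) : J2 (fun t => (t - c) ^ 2) x (2 * (x - c)) 2 := by
  refine J2.of (φ' := fun t => 2 * (t - c)) (fun t => ?_) ?_
  · have := ((hasDerivAt_id t).sub_const c).fun_pow 2
    simpa using this
  · have := ((hasDerivAt_id x).sub_const c).const_mul 2
    simpa using this

lemma Sol.le_one {U : ℝ × ℝ × ℝ → ℝ} (h : Sol U) (p : ℝ × ℝ × ℝ) : U p ≤ 1 := by
  obtain ⟨x0, y0, z0⟩ := p
  by_contra hlt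
  push Not at hlt
  set v0 := U (x0, y0, z0) - 1 with hv0
  have hv0p : 0 < v0 := by linarith
  set R : ℝ := 4 / v0 with hR
  have hRp : 0 < R := by positivity
  let ζ : ℝ × ℝ × ℝ → ℝ := fun p =>
    R ^ 2 + (-1) * ((p.1 - x0) ^ 2 + (p.2.1 - y0) ^ 2 + (p.2.2 - z0) ^ 2)
  have hζc : Continuous ζ := by fun_prop
  let P : ℝ × ℝ × ℝ → ℝ := fun p => (U p + (-1)) * ζ p
  have hPc : Continuous P := by have := h.cont; fun_prop
  have hC : IsClosed {p | 0 ≤ ζ p} := isClosed_le continuous_const hζc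
  obtain ⟨x, y, z, hp, hpp, hmax⟩ := exists_max_on (F := P) hC hPc.continuousOn
    (R := |x0| + |y0| + |z0| + R) (by
      intro x y z hp _
      simp only [ζ, Set.mem_ofPred_eq] at hp
      have e1 : |x - x0| ≤ R := abs_le_of_sq_le_sq (by nlinarith [sq_nonneg (y - y0), sq_nonneg (z - z0)]) hRp.le
      have e2 : |y - y0| ≤ R := abs_le_of_sq_le_sq (by nlinarith [sq_nonneg (x - x0), sq_nonneg (z - z0)]) hRp.le
      have e3 : |z - z0| ≤ R := abs_le_of_sq_le_sq (by nlinarith [sq_nonneg (x - x0), sq_nonneg (y - y0)]) hRp.le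
      have := abs_sub_abs_le_abs_sub x x0
      have := abs_sub_abs_le_abs_sub y y0
      have := abs_sub_abs_le_abs_sub z z0
      have := abs_nonneg x0
      have := abs_nonneg y0
      have := abs_nonneg z0
      refine ⟨?_, ?_, ?_⟩ <;> linarith) (p0 := (x0, y0, z0))
    (by simp [ζ]; positivity) (by simp [P, ζ]; refine mul_pos (by linarith) (by positivity))
  have hζp : 0 < ζ (x, y, z) := by
    rcases lt_or_eq_of_le (show 0 ≤ ζ (x, y, z) from hp) with h1 | h1
    · exact h1
    · simp [P, ← h1] at hpp
  have hv : 0 < U (x, y, z) + (-1) := pos_of_mul_pos_left hpp hζp.le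
  have hloc : IsLocalMax P (x, y, z) := by
    filter_upwards [hζc.continuousAt.eventually (lt_mem_nhds hζp)] with q hq
    exact hmax q hq.le
  obtain ⟨a1, b1, a2, b2, a3, b3, h1, h2, h3, he⟩ := h.pde x y z
  have k1 := (h1.add (J2.const (-1) x)).mul ((J2.const (R ^ 2) x).add
    ((((J2.sq x x0).add (J2.const ((y - y0) ^ 2) x)).add (J2.const ((z - z0) ^ 2) x)).constMul (-1)))
  have k2 := (h2.add (J2.const (-1) y)).mul ((J2.const (R ^ 2) y).add
    ((((J2.const ((x - x0) ^ 2) y).add (J2.sq y y0)).add (J2.const ((z - z0) ^ 2) y)).constMul (-1)))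
  have k3 := (h3.add (J2.const (-1) z)).mul ((J2.const (R ^ 2) z).add
    ((((J2.const ((x - x0) ^ 2) z).add (J2.const ((y - y0) ^ 2) z)).add (J2.sq z z0)).constMul (-1)))
  obtain ⟨e1, e2, e3, e4⟩ := max3 hloc k1 k2 k3
  have hP0 : v0 * R ^ 2 ≤ (U (x, y, z) + (-1)) * ζ (x, y, z) := by
    have := hmax (x0, y0, z0) (by simp [ζ]; positivity)
    simp only [P] at this
    have h2 : ζ (x0, y0, z0) = R ^ 2 := by simp [ζ]
    rw [h2] at this
    simpa [hv0, sub_eq_add_neg] using this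
  have hζe : R ^ 2 + (-1) * ((x - x0) ^ 2 + (y - y0) ^ 2 + (z - z0) ^ 2) = ζ (x, y, z) := rfl
  rw [hζe] at e1 e2 e3 e4
  generalize ζ (x, y, z) = Z at *
  set v := U (x, y, z) + (-1) with hvd
  have hU : U (x, y, z) = v + 1 := by rw [hvd]; ring
  rw [hU] at he
  have key : Z ^ 2 * (b1 + b2 + b3) ≤ v * (8 * R ^ 2 - 2 * Z) := by
    have := mul_le_mul_of_nonneg_left e4 hζp.le
    have f1 : a1 * Z = 2 * v * (x - x0) := by linarith
    have f2 : a2 * Z = 2 * v * (y - y0) := by linarith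
    have f3 : a3 * Z = 2 * v * (z - z0) := by linarith
    have hs : (x - x0) ^ 2 + (y - y0) ^ 2 + (z - z0) ^ 2 = R ^ 2 - Z := by linarith
    have : Z ^ 2 * (b1 + b2 + b3) - 4 * (x - x0) * (a1 * Z) - 4 * (y - y0) * (a2 * Z)
      - 4 * (z - z0) * (a3 * Z) - 6 * v * Z ≤ 0 := by linarith
    rw [f1, f2, f3] at this
    have h8 : v * (8 * R ^ 2 - 2 * Z) = 8 * v * ((x - x0) ^ 2 + (y - y0) ^ 2 + (z - z0) ^ 2)
      + 6 * v * Z := by rw [hs]; ring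
    rw [h8]
    linarith
  rw [he] at key
  have hb : Z ^ 2 * v ^ 3 ≤ v * (8 * R ^ 2) := by
    have : 0 ≤ Z ^ 2 * (3 * v ^ 2 + 2 * v) := by positivity
    nlinarith [mul_pos hv hζp]
  have hb2 : (v * Z) ^ 2 ≤ 8 * R ^ 2 := by
    have : v * (v * Z) ^ 2 ≤ v * (8 * R ^ 2) := by linarith
    exact le_of_mul_le_mul_left this hv
  have hvR : v0 * R ^ 2 = 4 * R := by rw [hR]; field_simp
  rw [hvR] at hP0
  nlinarith [mul_pos hv hζp]

lemma J2.cos (x c : ℝ) : J2 (fun t => Real.cos ((t - c) / 4)) x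
    (-(1/4) * Real.sin ((x - c) / 4)) (-(1/16) * Real.cos ((x - c) / 4)) := by
  have hd : ∀ t, HasDerivAt (fun t : ℝ => (t - c) / 4) (1/4) t := fun t =>
    ((hasDerivAt_id t).sub_const c).div_const 4
  refine J2.of (φ' := fun t => -(1/4) * Real.sin ((t - c) / 4)) (fun t => ?_) ?_
  · refine (hd t).cos.congr_deriv ?_
    ring
  · refine ((hd x).sin.const_mul (-(1/4))).congr_deriv ?_
    ring

lemma Sol.big {U : ℝ × ℝ × ℝ → ℝ} (h : Sol U)
    (hpos : ∀ x y z, z ≤ 0 → 0 < U (x, y, z)) (x0 y0 z0 : ℝ) (hz0 : z0 ≤ -7) :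
    9 / 10 ≤ U (x0, y0, z0) := by
  let ζ : ℝ × ℝ × ℝ → ℝ := fun p =>
    Real.cos ((p.1 - x0) / 4) * Real.cos ((p.2.1 - y0) / 4) * Real.cos ((p.2.2 - z0) / 4)
  have hζc : Continuous ζ := by fun_prop
  set Q := Metric.closedBall ((x0, y0, z0) : ℝ × ℝ × ℝ) (2 * Real.pi) with hQ
  have hpi : Real.pi < 3.15 := Real.pi_lt_d2
  have hpi0 := Real.pi_pos
  have hmem : ∀ x y z, (x, y, z) ∈ Q ↔ |x - x0| ≤ 2 * Real.pi ∧ |y - y0| ≤ 2 * Real.pi ∧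
      |z - z0| ≤ 2 * Real.pi := by
    intro x y z
    simp [hQ, Metric.mem_closedBall, Prod.dist_eq, Real.dist_eq]
  have hvQ : ∀ q ∈ Q, 0 < U q := by
    rintro ⟨x, y, z⟩ hq
    have h3 := abs_le.1 ((hmem x y z).1 hq).2.2
    exact hpos x y z (by linarith)
  have hc0 : ((x0, y0, z0) : ℝ × ℝ × ℝ) ∈ Q := by
    rw [hmem]; simp [hpi0.le]
  obtain ⟨⟨x, y, z⟩, hp, hmax⟩ := (isCompact_closedBall ((x0, y0, z0) : ℝ × ℝ × ℝ)
    (2 * Real.pi)).exists_isMaxOn ⟨_, hc0⟩ (f := fun q => ζ q / U q)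
    (hζc.continuousOn.div h.cont.continuousOn (fun q hq => (hvQ q hq).ne'))
  have hv := hvQ _ hp
  have hv0 := hvQ _ hc0
  have hζ0 : ζ (x0, y0, z0) = 1 := by simp [ζ]
  have h0 := hmax hc0
  simp only [Set.mem_ofPred_eq, hζ0] at h0
  set k := ζ (x, y, z) / U (x, y, z) with hk
  have hkp : 0 < k := lt_of_lt_of_le (by positivity) h0
  have hζk : ζ (x, y, z) = k * U (x, y, z) := by rw [hk]; field_simp
  have hζp : 0 < ζ (x, y, z) := by rw [hζk]; positivity
  obtain ⟨m1, m2, m3⟩ := (hmem x y z).1 hp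
  have hcos : ∀ s, |s| ≤ 2 * Real.pi → Real.cos (s / 4) ≠ 0 → |s| < 2 * Real.pi := by
    intro s hs hc
    refine lt_of_le_of_ne hs fun he => hc ?_
    rcases abs_eq (by positivity) |>.1 he with h1 | h1
    · rw [h1, show 2 * Real.pi / 4 = Real.pi / 2 by ring]; simp
    · rw [h1, show -(2 * Real.pi) / 4 = -(Real.pi / 2) by ring, Real.cos_neg]; simp
  have hne : Real.cos ((x - x0) / 4) * Real.cos ((y - y0) / 4) * Real.cos ((z - z0) / 4) ≠ 0 :=
    hζp.ne'
  have n1 := hcos _ m1 (fun h => hne (by rw [h]; ring))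
  have n2 := hcos _ m2 (fun h => hne (by rw [h]; ring))
  have n3 := hcos _ m3 (fun h => hne (by rw [h]; ring))
  have hball : ((x, y, z) : ℝ × ℝ × ℝ) ∈ Metric.ball ((x0, y0, z0) : ℝ × ℝ × ℝ) (2 * Real.pi) := by
    simp [Metric.mem_ball, Prod.dist_eq, Real.dist_eq, n1, n2, n3]
  have hloc : IsLocalMax (fun q => ζ q + (-k) * U q) (x, y, z) := by
    filter_upwards [Metric.isOpen_ball.mem_nhds hball] with q hq
    have hq' := Metric.ball_subset_closedBall hq
    have := hmax hq'
    simp only [Set.mem_ofPred_eq] at this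
    rw [← hk, div_le_iff₀ (hvQ q hq')] at this
    rw [hζk]
    linarith
  obtain ⟨a1, b1, a2, b2, a3, b3, h1, h2, h3, he⟩ := h.pde x y z
  have k1 := (((J2.cos x x0).mul (J2.const (Real.cos ((y - y0) / 4)) x)).mul
    (J2.const (Real.cos ((z - z0) / 4)) x)).add (h1.constMul (-k))
  have k2 := (((J2.const (Real.cos ((x - x0) / 4)) y).mul (J2.cos y y0)).mul
    (J2.const (Real.cos ((z - z0) / 4)) y)).add (h2.constMul (-k))
  have k3 := (((J2.const (Real.cos ((x - x0) / 4)) z).mul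
    (J2.const (Real.cos ((y - y0) / 4)) z)).mul (J2.cos z z0)).add (h3.constMul (-k))
  obtain ⟨-, -, -, e4⟩ := max3 hloc k1 k2 k3
  have hζe : Real.cos ((x - x0) / 4) * Real.cos ((y - y0) / 4) * Real.cos ((z - z0) / 4)
      = k * U (x, y, z) := hζk
  have e5 : -(3/16) * (k * U (x, y, z)) - k * (U (x, y, z) ^ 3 - U (x, y, z)) ≤ 0 := by
    rw [← he, ← hζe]; linarith
  have e6 : 13 / 16 ≤ U (x, y, z) ^ 2 := by
    by_contra hc
    push Not at hc
    have : 0 < k * U (x, y, z) * (13 / 16 - U (x, y, z) ^ 2) := by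
      apply mul_pos (by positivity); linarith
    linarith
  have e7 : 9 / 10 ≤ U (x, y, z) := by nlinarith
  have hζ1 : ζ (x, y, z) ≤ 1 := by
    have hab : |ζ (x, y, z)| ≤ 1 := by
      simp only [ζ, abs_mul]
      have := Real.abs_cos_le_one ((x - x0) / 4)
      have := Real.abs_cos_le_one ((y - y0) / 4)
      have := Real.abs_cos_le_one ((z - z0) / 4)
      refine mul_le_one₀ (mul_le_one₀ ?_ ?_ ?_) ?_ ?_ <;> first | assumption | positivity
    exact (le_abs_self _).trans hab
  rw [div_le_iff₀ hv0] at h0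
  -- 1 ≤ k * U0 , k * U ≤ 1
  have : k * U (x, y, z) ≤ k * U (x0, y0, z0) := by linarith
  have := le_of_mul_le_mul_left this hkp
  linarith

lemma J2.exp (x c : ℝ) : J2 (fun t => Real.exp (c * t)) x
    (c * Real.exp (c * x)) (c ^ 2 * Real.exp (c * x)) := by
  have hd : ∀ t, HasDerivAt (fun t : ℝ => c * t) c t := fun t => by
    simpa using (hasDerivAt_id t).const_mul c
  refine J2.of (φ' := fun t => c * Real.exp (c * t)) (fun t => ?_) ?_
  · refine (hd t).exp.congr_deriv ?_
    ring
  · refine ((hd x).exp.const_mul c).congr_deriv ?_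
    ring

lemma J2.sq' (x : ℝ) : J2 (fun t => t ^ 2) x (2 * x) 2 := by
  simpa using J2.sq x 0

lemma abs_le_of_sq_le {x K : ℝ} (h : x ^ 2 ≤ K) : |x| ≤ K + 1 := by
  have := abs_nonneg x
  rw [← sq_abs] at h
  nlinarith

lemma Sol.one_sub {U : ℝ × ℝ × ℝ → ℝ} (h : Sol U)
    (hneg : ∀ x y z, z ≤ 0 → U (x, y, z) < 0) (x0 y0 z0 : ℝ) (hz0 : 0 ≤ z0) :
    Real.exp (-√2 * z0) ≤ 1 - U (x0, y0, z0) := by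
  by_contra hlt
  push Not at hlt
  set d := Real.exp (-√2 * z0) - (1 - U (x0, y0, z0)) with hd
  have hdp : 0 < d := by linarith
  set m := x0 ^ 2 + y0 ^ 2 + z0 ^ 2 + 4 with hm
  have hmp : 0 < m := by positivity
  set ε := d / (2 * m) with hε
  have hεp : 0 < ε := by positivity
  have hr : √2 ^ 2 = 2 := Real.sq_sqrt (by norm_num)
  have hr0 : 0 ≤ √2 := Real.sqrt_nonneg 2
  let F : ℝ × ℝ × ℝ → ℝ := fun p => (Real.exp (-√2 * p.2.2) + (U p + (-1)))
    + (-ε) * (p.1 ^ 2 + p.2.1 ^ 2 + p.2.2 ^ 2 + 4)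
  have hFc : Continuous F := by have := h.cont; fun_prop
  have hle := h.le_one
  have hge : ∀ p, -1 ≤ U p := fun p => by linarith [h.neg.le_one p]
  have hE1 : ∀ z : ℝ, 0 ≤ z → Real.exp (-√2 * z) ≤ 1 := fun z hz => by
    rw [Real.exp_le_one_iff]; nlinarith
  obtain ⟨x, y, z, hp, hpp, hmax⟩ := exists_max_on (F := F) (C := {p | 0 ≤ p.2.2})
    (isClosed_le continuous_const (by fun_prop)) hFc.continuousOn (R := 1 / ε + 1) (by
      intro x y z hp hpp
      simp only [F, Set.mem_ofPred_eq] at hp hpp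
      have h1 := hle (x, y, z)
      have h2 := hE1 z hp
      have h3 : ε * (x ^ 2 + y ^ 2 + z ^ 2 + 4) ≤ 1 := by linarith
      have h4 : x ^ 2 + y ^ 2 + z ^ 2 + 4 ≤ 1 / ε := by
        rw [le_div_iff₀ hεp]; linarith
      refine ⟨abs_le_of_sq_le ?_, abs_le_of_sq_le ?_, abs_le_of_sq_le ?_⟩ <;>
      nlinarith [sq_nonneg x, sq_nonneg y, sq_nonneg z]) (p0 := (x0, y0, z0)) hz0 (by
      have : ε * m = d / 2 := by rw [hε]; field_simp
      show 0 < (Real.exp (-√2 * z0) + (U (x0, y0, z0) + (-1))) + (-ε) * m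
      linarith)
  have hz : 0 < z := by
    rcases lt_or_eq_of_le (show 0 ≤ z from hp) with h1 | h1
    · exact h1
    · have := hneg x y z h1.symm.le
      simp only [F, ← h1] at hpp this
      simp only [mul_zero, Real.exp_zero] at hpp
      have : 0 < ε * (x ^ 2 + y ^ 2 + 0 ^ 2 + 4) := by positivity
      linarith
  have hloc : IsLocalMax F (x, y, z) := by
    have : ∀ᶠ q : ℝ × ℝ × ℝ in 𝓝 (x, y, z), 0 < q.2.2 :=
      (isOpen_lt continuous_const (by fun_prop)).mem_nhds hz
    filter_upwards [this] with q hq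
    exact hmax q hq.le
  obtain ⟨a1, b1, a2, b2, a3, b3, h1, h2, h3, he⟩ := h.pde x y z
  have k1 := ((J2.const (Real.exp (-√2 * z)) x).add (h1.add (J2.const (-1) x))).add
    (((((J2.sq' x).add (J2.const (y ^ 2) x)).add (J2.const (z ^ 2) x)).add
      (J2.const 4 x)).constMul (-ε))
  have k2 := ((J2.const (Real.exp (-√2 * z)) y).add (h2.add (J2.const (-1) y))).add
    (((((J2.const (x ^ 2) y).add (J2.sq' y)).add (J2.const (z ^ 2) y)).add
      (J2.const 4 y)).constMul (-ε))
  have k3 := ((J2.exp z (-√2)).add (h3.add (J2.const (-1) z))).add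
    (((((J2.const (x ^ 2) z).add (J2.const (y ^ 2) z)).add (J2.sq' z)).add
      (J2.const 4 z)).constMul (-ε))
  obtain ⟨-, -, -, e4⟩ := max3 hloc k1 k2 k3
  rw [neg_sq, hr] at e4
  simp only [F] at hpp
  have f1 := hle (x, y, z)
  have f2 := hge (x, y, z)
  generalize U (x, y, z) = v at *
  have f3 : 0 ≤ (1 - v) * (2 - v * (1 + v)) := by
    apply mul_nonneg (by linarith); nlinarith
  have : 0 ≤ ε * (x ^ 2 + y ^ 2 + z ^ 2) := by positivity
  nlinarith

noncomputable def Nf (U : ℝ × ℝ × ℝ → ℝ) (p : ℝ × ℝ × ℝ) : ℝ :=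
  Real.exp (-√2 * p.2.2) * ((1 + U p) / (1 - U p))

lemma frac_deriv {s : ℝ} (hs : s < 1) :
    HasDerivAt (fun s : ℝ => (1 + s) / (1 - s)) (2 / (1 - s) ^ 2) s := by
  have h1 : HasDerivAt (fun s : ℝ => 1 + s) 1 s := (hasDerivAt_id s).const_add 1
  have h2 : HasDerivAt (fun s : ℝ => 1 - s) (-1) s := (hasDerivAt_id s).const_sub 1
  have hne : 1 - s ≠ 0 := by linarith
  refine (h1.div h2 hne).congr_deriv ?_
  ring

lemma frac_deriv2 {s : ℝ} (hs : s < 1) :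
    HasDerivAt (fun s : ℝ => 2 / (1 - s) ^ 2) (4 / (1 - s) ^ 3) s := by
  have h2 : HasDerivAt (fun s : ℝ => 1 - s) (-1) s := (hasDerivAt_id s).const_sub 1
  have hne : 1 - s ≠ 0 := by linarith
  refine ((hasDerivAt_const s (2 : ℝ)).div (h2.fun_pow 2) (by positivity)).congr_deriv ?_
  field_simp
  ring

lemma J2.frac {φ : ℝ → ℝ} {x a b : ℝ} (h : J2 φ x a b) (hlt : φ x < 1) :
    J2 (fun t => (1 + φ t) / (1 - φ t)) x (2 / (1 - φ x) ^ 2 * a)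
      (4 / (1 - φ x) ^ 3 * a ^ 2 + 2 / (1 - φ x) ^ 2 * b) :=
  h.comp (G := fun s => (1 + s) / (1 - s)) (G' := fun s => 2 / (1 - s) ^ 2)
    (by filter_upwards [gt_mem_nhds hlt] with s hs using frac_deriv hs) (frac_deriv2 hlt)

lemma Nf_pde {U : ℝ × ℝ × ℝ → ℝ} (h : Sol U) (hlt : ∀ p, U p < 1) (x y z : ℝ) :
    ∃ a1 b1 a2 b2 a3 b3, J2 (fun t => Nf U (t, y, z)) x a1 b1 ∧
    J2 (fun t => Nf U (x, t, z)) y a2 b2 ∧ J2 (fun t => Nf U (x, y, t)) z a3 b3 ∧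
    2 * √2 * U (x, y, z) * a3 ≤ b1 + b2 + b3 := by
  obtain ⟨a1, b1, a2, b2, a3, b3, h1, h2, h3, he⟩ := h.pde x y z
  have k1 := (h1.frac (hlt _)).constMul (Real.exp (-√2 * z))
  have k2 := (h2.frac (hlt _)).constMul (Real.exp (-√2 * z))
  have k3 := (J2.exp z (-√2)).mul (h3.frac (hlt _))
  refine ⟨_, _, _, _, _, _, k1, k2, k3, ?_⟩
  have hv := hlt (x, y, z)
  set E := Real.exp (-√2 * z) with hE
  have hEp : 0 < E := Real.exp_pos _
  generalize U (x, y, z) = v at *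
  set r := √2 with hr'
  have hr : r ^ 2 = 2 := Real.sq_sqrt (by norm_num)
  have hw : 0 < 1 - v := by linarith
  have hb1 : b1 = v ^ 3 - v - b2 - b3 := by linarith
  rw [← sub_nonneg]
  have key : 0 ≤ E * (4 / (1 - v) ^ 3) * (a1 ^ 2 + a2 ^ 2 + (a3 - r * (1 - v ^ 2) / 2) ^ 2) := by
    positivity
  refine key.trans_eq ?_
  rw [hb1]
  field_simp
  ring_nf
  simp only [hr]
  ring

lemma Nf_cont {U : ℝ × ℝ × ℝ → ℝ} (h : Sol U) (hlt : ∀ p, U p < 1) : Continuous (Nf U) := by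
  have := h.cont
  unfold Nf
  refine Continuous.mul (by fun_prop) (Continuous.div (by fun_prop) (by fun_prop) ?_)
  intro p
  linarith [hlt p]

set_option maxHeartbeats 2000000 in
lemma Nf_low {U : ℝ × ℝ × ℝ → ℝ} (h : Sol U) (hlt : ∀ p, U p < 1)
    (hneg : ∀ x y z, z ≤ 0 → U (x, y, z) < 0) (x0 y0 z0 : ℝ) (hz0 : z0 ≤ -7) :
    Nf U (x0, y0, z0) ≤ Real.exp (-√2 * (-7)) := by
  by_contra hcon
  push Not at hcon
  set B := Real.exp (-√2 * (-7)) with hB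
  have hBp : 0 < B := Real.exp_pos _
  have hr : √2 ^ 2 = 2 := Real.sq_sqrt (by norm_num)
  have hr0 : 0 ≤ √2 := Real.sqrt_nonneg 2
  have hr1 : √2 ≤ 3 / 2 := by nlinarith
  have hr2 : 7 / 5 ≤ √2 := by nlinarith
  set m := Real.exp (-2 * z0) * (x0 ^ 2 + y0 ^ 2 + 8) with hm
  have hmp : 0 < m := by positivity
  set d := Nf U (x0, y0, z0) - B with hd
  have hdp : 0 < d := by linarith
  set ε := d / (2 * m) with hε
  have hεp : 0 < ε := by positivity
  have hεm : ε * m = d / 2 := by rw [hε]; field_simp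
  have hNle : ∀ x y z, z ≤ 0 → Nf U (x, y, z) ≤ Real.exp (-√2 * z) := by
    intro x y z hz
    have h1 := hneg x y z hz
    have : (1 + U (x, y, z)) / (1 - U (x, y, z)) ≤ 1 := by
      rw [div_le_one (by linarith)]; linarith
    exact mul_le_of_le_one_right (Real.exp_pos _).le this
  let F : ℝ × ℝ × ℝ → ℝ := fun p => (Nf U p + (-ε) * (Real.exp (-2 * p.2.2) *
    (p.1 ^ 2 + p.2.1 ^ 2 + 8))) + (-B)
  have hFc : Continuous F := by have := Nf_cont h hlt; fun_prop
  obtain ⟨x, y, z, hp, hpp, hmax⟩ := exists_max_on (F := F) (C := {p | p.2.2 ≤ -7})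
    (isClosed_le (by fun_prop) continuous_const) hFc.continuousOn (R := 1 / ε + 1) (by
      intro x y z hp hpp
      simp only [F, Set.mem_ofPred_eq] at hp hpp
      have h1 := hNle x y z (by linarith)
      have h2 : Real.exp (-√2 * z) ≤ Real.exp (-(3/2) * z) := by
        rw [Real.exp_le_exp]; nlinarith
      have h3 : ε * (Real.exp (-2 * z) * (x ^ 2 + y ^ 2 + 8)) < Real.exp (-(3/2) * z) := by linarith
      have h4 : Real.exp (-2 * z) = Real.exp (-(3/2) * z) * Real.exp (-(1/2) * z) := by
        rw [← Real.exp_add]; ring_nf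
      have h5 : ε * (Real.exp (-(1/2) * z) * (x ^ 2 + y ^ 2 + 8)) < 1 := by
        have hpos := Real.exp_pos (-(3/2) * z)
        rw [h4] at h3
        by_contra hc
        push Not at hc
        nlinarith
      have h6 : Real.exp (-(1/2) * z) * (x ^ 2 + y ^ 2 + 8) ≤ 1 / ε := by
        rw [le_div_iff₀ hεp]; linarith
      have h7 := Real.add_one_le_exp (-(1/2) * z)
      have hx := sq_nonneg x
      have hy := sq_nonneg y
      have h8 : x ^ 2 + y ^ 2 + 8 ≤ 1 / ε := by nlinarith
      have h9 : (-(1/2) * z + 1) * 8 ≤ 1 / ε := by nlinarith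
      refine ⟨abs_le_of_sq_le ?_, abs_le_of_sq_le ?_, ?_⟩
      · linarith
      · linarith
      · rw [abs_of_nonpos (by linarith)]; linarith) (p0 := (x0, y0, z0)) hz0 (by
      show 0 < (Nf U (x0, y0, z0) + (-ε) * m) + (-B)
      linarith)
  have hz : z < -7 := by
    rcases lt_or_eq_of_le (show z ≤ -7 from hp) with h1 | h1
    · exact h1
    · have h2 := hNle x y z (by linarith)
      simp only [F] at hpp
      have h3 : 0 < ε * (Real.exp (-2 * z) * (x ^ 2 + y ^ 2 + 8)) := by positivity
      rw [h1] at h2 h3 hpp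
      linarith
  have hloc : IsLocalMax F (x, y, z) := by
    have : ∀ᶠ q : ℝ × ℝ × ℝ in 𝓝 (x, y, z), q.2.2 < -7 :=
      (isOpen_lt (by fun_prop) continuous_const).mem_nhds hz
    filter_upwards [this] with q hq
    exact hmax q hq.le
  obtain ⟨a1, b1, a2, b2, a3, b3, h1, h2, h3, he⟩ := Nf_pde h hlt x y z
  have k1 := (h1.add ((((((J2.sq' x).add (J2.const (y ^ 2) x)).add
    (J2.const 8 x)).constMul (Real.exp (-2 * z)))).constMul (-ε))).add (J2.const (-B) x)
  have k2 := (h2.add ((((((J2.const (x ^ 2) y).add (J2.sq' y)).add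
    (J2.const 8 y)).constMul (Real.exp (-2 * z)))).constMul (-ε))).add (J2.const (-B) y)
  have k3 := (h3.add (((J2.exp z (-2)).mul (J2.const (x ^ 2 + y ^ 2 + 8) z)).constMul (-ε))).add
    (J2.const (-B) z)
  obtain ⟨-, -, e3, e4⟩ := max3 hloc k1 k2 k3
  have hu : U (x, y, z) ≤ -(9 / 10) := by
    have := h.neg.big (fun x y z hz => by linarith [hneg x y z hz]) x y z hz.le
    linarith
  set q := x ^ 2 + y ^ 2 + 8 with hq
  have hq8 : 8 ≤ q := by nlinarith [sq_nonneg x, sq_nonneg y]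
  set E := Real.exp (-2 * z)
  have hE : 0 < E := Real.exp_pos _
  have ha3 : a3 = -(2 * ε * E * q) := by linarith
  have hb : b1 + b2 + b3 ≤ ε * E * (4 * q + 4) := by linarith
  rw [ha3] at he
  have hεE : 0 < ε * E := by positivity
  have h5 : 63 / 50 ≤ √2 * (-U (x, y, z)) := by nlinarith
  have h6 : ε * E * (4 * q * (63 / 50)) ≤ ε * E * (4 * q * (√2 * (-U (x, y, z)))) := by gcongr
  have h7 : ε * E * (4 * q * (63 / 50)) ≤ ε * E * (4 * q + 4) := by linarith
  have h8 := le_of_mul_le_mul_left h7 hεE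
  linarith

lemma J2.gauss {φ : ℝ → ℝ} {x a b : ℝ} (h : J2 φ x a b) (k : ℝ) :
    J2 (fun t => Real.exp (k * φ t)) x (k * Real.exp (k * φ x) * a)
      (k ^ 2 * Real.exp (k * φ x) * a ^ 2 + k * Real.exp (k * φ x) * b) := by
  have hd : ∀ t, HasDerivAt (fun t : ℝ => k * t) k t := fun t => by
    simpa using (hasDerivAt_id t).const_mul k
  refine h.comp (G := fun s => Real.exp (k * s)) (G' := fun s => k * Real.exp (k * s))
    (Eventually.of_forall fun s => ?_) ?_
  · refine (hd s).exp.congr_deriv ?_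
    ring
  · refine ((hd _).exp.const_mul k).congr_deriv ?_
    ring

set_option maxHeartbeats 2000000 in
lemma strong_max {N u : ℝ × ℝ × ℝ → ℝ} (hc : Continuous N) (hN1 : ∀ p, N p ≤ 1)
    (hu : ∀ p, |u p| ≤ 1)
    (hpde : ∀ x y z, ∃ a1 b1 a2 b2 a3 b3, J2 (fun t => N (t, y, z)) x a1 b1 ∧
      J2 (fun t => N (x, t, z)) y a2 b2 ∧ J2 (fun t => N (x, y, t)) z a3 b3 ∧
      2 * √2 * u (x, y, z) * a3 ≤ b1 + b2 + b3)
    (p0 : ℝ × ℝ × ℝ) (hp0 : N p0 = 1) (p : ℝ × ℝ × ℝ) : N p = 1 := by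
  by_contra hne
  have hlt : N p < 1 := lt_of_le_of_ne (hN1 p) hne
  obtain ⟨xc, yc, zc⟩ := p
  have hr : √2 ^ 2 = 2 := Real.sq_sqrt (by norm_num)
  have hr0 : 0 ≤ √2 := Real.sqrt_nonneg 2
  have hr1 : √2 ≤ 3 / 2 := by nlinarith
  let D : ℝ × ℝ × ℝ → ℝ := fun p => (p.1 - xc) ^ 2 + (p.2.1 - yc) ^ 2 + (p.2.2 - zc) ^ 2
  have hDc : Continuous D := by fun_prop
  set m := (1 - N (xc, yc, zc)) / 2 with hm
  have hmp : 0 < m := by linarith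
  obtain ⟨δ, hδ, hball⟩ := Metric.eventually_nhds_iff.1
    (hc.continuousAt.eventually (gt_mem_nhds (show N (xc, yc, zc) < 1 - m by linarith)))
  set ρ := δ / 2 with hρ
  have hρp : 0 < ρ := by positivity
  have hsmall : ∀ x y z, D (x, y, z) ≤ ρ ^ 2 → N (x, y, z) < 1 - m := by
    intro x y z hD
    simp only [D] at hD
    apply hball
    have e1 : |x - xc| ≤ ρ := abs_le_of_sq_le_sq (by nlinarith [sq_nonneg (y - yc), sq_nonneg (z - zc)]) hρp.le
    have e2 : |y - yc| ≤ ρ := abs_le_of_sq_le_sq (by nlinarith [sq_nonneg (x - xc), sq_nonneg (z - zc)]) hρp.le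
    have e3 : |z - zc| ≤ ρ := abs_le_of_sq_le_sq (by nlinarith [sq_nonneg (x - xc), sq_nonneg (y - yc)]) hρp.le
    have hρδ : ρ < δ := by linarith
    simp only [Prod.dist_eq, Real.dist_eq]
    exact max_lt (by linarith) (max_lt (by linarith) (by linarith))
  set T := D p0 + 1 with hT
  have hD0 : ρ ^ 2 < D p0 := by
    by_contra hcc
    push Not at hcc
    have := hsmall p0.1 p0.2.1 p0.2.2 hcc
    have h2 : N (p0.1, p0.2.1, p0.2.2) = N p0 := rfl
    linarith
  set a := (3 + 3 * ρ) / ρ ^ 2 with ha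
  have hap : 0 < a := by positivity
  let F : ℝ × ℝ × ℝ → ℝ := fun p => N p + (m * Real.exp ((-a) * D p) + (-1 - m * Real.exp ((-a) * T)))
  have hFc : Continuous F := by fun_prop
  obtain ⟨x, y, z, hp, hpp, hmax⟩ := exists_max_on (F := F) (C := {p | ρ ^ 2 ≤ D p} ∩ {p | D p ≤ T})
    ((isClosed_le continuous_const hDc).inter (isClosed_le hDc continuous_const)) hFc.continuousOn
    (R := |xc| + |yc| + |zc| + (T + 1)) (by
      rintro x y z ⟨-, hp⟩ -
      simp only [D, Set.mem_ofPred_eq] at hp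
      have e1 : |x - xc| ≤ T + 1 := abs_le_of_sq_le (by nlinarith [sq_nonneg (y - yc), sq_nonneg (z - zc)])
      have e2 : |y - yc| ≤ T + 1 := abs_le_of_sq_le (by nlinarith [sq_nonneg (x - xc), sq_nonneg (z - zc)])
      have e3 : |z - zc| ≤ T + 1 := abs_le_of_sq_le (by nlinarith [sq_nonneg (x - xc), sq_nonneg (y - yc)])
      have := abs_sub_abs_le_abs_sub x xc
      have := abs_sub_abs_le_abs_sub y yc
      have := abs_sub_abs_le_abs_sub z zc
      have := abs_nonneg xc
      have := abs_nonneg yc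
      have := abs_nonneg zc
      refine ⟨?_, ?_, ?_⟩ <;> linarith) (p0 := p0)
    ⟨hD0.le, by simp only [hT, Set.mem_ofPred_eq]; linarith⟩ (by
      simp only [F]
      have : Real.exp ((-a) * T) < Real.exp ((-a) * D p0) := by
        rw [Real.exp_lt_exp]; nlinarith
      nlinarith)
  obtain ⟨hp1, hp2⟩ := hp
  simp only [Set.mem_ofPred_eq] at hp1 hp2
  simp only [F] at hpp
  have hq1 : ρ ^ 2 < D (x, y, z) := by
    refine lt_of_le_of_ne hp1 fun he => ?_
    have h1 := hsmall x y z he.symm.le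
    have h2 : Real.exp ((-a) * D (x, y, z)) ≤ 1 := by
      rw [Real.exp_le_one_iff]; nlinarith
    have h3 := Real.exp_pos ((-a) * T)
    nlinarith
  have hq2 : D (x, y, z) < T := by
    refine lt_of_le_of_ne hp2 fun he => ?_
    have h1 := hN1 (x, y, z)
    rw [he] at hpp
    linarith
  have hloc : IsLocalMax F (x, y, z) := by
    filter_upwards [hDc.continuousAt.eventually (lt_mem_nhds hq1),
      hDc.continuousAt.eventually (gt_mem_nhds hq2)] with q h1 h2
    exact hmax q ⟨h1.le, h2.le⟩
  obtain ⟨a1, b1, a2, b2, a3, b3, h1, h2, h3, he⟩ := hpde x y z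
  have k1 := h1.add ((((((J2.sq x xc).add (J2.const ((y - yc) ^ 2) x)).add
    (J2.const ((z - zc) ^ 2) x)).gauss (-a)).constMul m).add
    (J2.const (-1 - m * Real.exp ((-a) * T)) x))
  have k2 := h2.add ((((((J2.const ((x - xc) ^ 2) y).add (J2.sq y yc)).add
    (J2.const ((z - zc) ^ 2) y)).gauss (-a)).constMul m).add
    (J2.const (-1 - m * Real.exp ((-a) * T)) y))
  have k3 := h3.add ((((((J2.const ((x - xc) ^ 2) z).add (J2.const ((y - yc) ^ 2) z)).add
    (J2.sq z zc)).gauss (-a)).constMul m).add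
    (J2.const (-1 - m * Real.exp ((-a) * T)) z))
  obtain ⟨-, -, e3, e4⟩ := max3 hloc k1 k2 k3
  have hDe : (x - xc) ^ 2 + (y - yc) ^ 2 + (z - zc) ^ 2 = D (x, y, z) := rfl
  rw [hDe] at e3 e4
  set d := D (x, y, z) with hd
  set E := Real.exp (-a * d) with hE
  have hEp : 0 < E := Real.exp_pos _
  have hsum : b1 + b2 + b3 ≤ - (m * E * a * (4 * a * d - 6)) := by
    rw [← hDe]; linarith
  have ha3 : a3 = 2 * (m * E * a) * (z - zc) := by linarith
  have hk : 0 < m * E * a := by positivity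
  rw [ha3] at he
  have h5 : m * E * a * (4 * (√2 * (u (x, y, z) * (z - zc)))) ≤ m * E * a * (-(4 * a * d - 6)) := by
    linarith
  have h6 := le_of_mul_le_mul_left h5 hk
  have hdp : 0 ≤ d := by rw [← hDe]; positivity
  set t := √d with ht
  have htd : t ^ 2 = d := Real.sq_sqrt hdp
  have ht0 : 0 ≤ t := Real.sqrt_nonneg _
  have hzt : |z - zc| ≤ t := Real.abs_le_sqrt (by rw [← hDe]; nlinarith [sq_nonneg (x - xc), sq_nonneg (y - yc)])
  have h7 : |u (x, y, z) * (z - zc)| ≤ t := by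
    rw [abs_mul]
    calc _ ≤ 1 * t := by
          apply mul_le_mul (hu _) hzt (abs_nonneg _) zero_le_one
      _ = t := one_mul t
  have h8 : -(3 / 2 * t) ≤ √2 * (u (x, y, z) * (z - zc)) := by
    have := (abs_le.1 h7).1
    nlinarith
  have h9 : 2 * a * d ≤ 3 + 3 * t := by linarith
  have htρ : ρ < t := by
    by_contra hcc
    push Not at hcc
    nlinarith
  rw [ha, ← htd] at h9
  have h10 : 2 * (3 + 3 * ρ) * t ^ 2 ≤ (3 + 3 * t) * ρ ^ 2 := by
    have : 2 * ((3 + 3 * ρ) / ρ ^ 2) * t ^ 2 * ρ ^ 2 = 2 * (3 + 3 * ρ) * t ^ 2 := by field_simp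
    rw [← this]
    gcongr
  have h11 : ρ ^ 2 < t ^ 2 := by nlinarith
  have h12 : ρ ^ 2 * t ≤ ρ * t ^ 2 := by nlinarith [mul_pos hρp (hρp.trans htρ)]
  nlinarith [mul_pos hρp (hρp.trans htρ)]

noncomputable def Gb (w s : ℝ) : ℝ := Real.log s + 2 - 48 / s + w / s ^ 2

lemma Gb_d1 (w : ℝ) {s : ℝ} (hs : 0 < s) :
    HasDerivAt (Gb w) (1 / s + 48 / s ^ 2 - 2 * w / s ^ 3) s := by
  have h1 := Real.hasDerivAt_log hs.ne'
  have h2 := (hasDerivAt_const s (48 : ℝ)).div (hasDerivAt_id s) hs.ne'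
  have h3 := (hasDerivAt_const s w).div ((hasDerivAt_id s).fun_pow 2) (by simpa using hs.ne')
  refine (((h1.add_const 2).sub h2).add h3).congr_deriv ?_
  simp only [id]
  field_simp
  ring

lemma Gb_d2 (w : ℝ) {s : ℝ} (hs : 0 < s) :
    HasDerivAt (fun s => 1 / s + 48 / s ^ 2 - 2 * w / s ^ 3)
      (-1 / s ^ 2 - 96 / s ^ 3 + 6 * w / s ^ 4) s := by
  have h1 := (hasDerivAt_const s (1 : ℝ)).div (hasDerivAt_id s) hs.ne'
  have h2 := (hasDerivAt_const s (48 : ℝ)).div ((hasDerivAt_id s).fun_pow 2) (by simpa using hs.ne')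
  have h3 := (hasDerivAt_const s (2 * w)).div ((hasDerivAt_id s).fun_pow 3) (by simpa using hs.ne')
  refine ((h1.add h2).sub h3).congr_deriv ?_
  simp only [id]
  field_simp
  ring

lemma J2.Gb {φ : ℝ → ℝ} {x a b : ℝ} (h : J2 φ x a b) (w : ℝ) (hp : 0 < φ x) :
    J2 (fun t => Gb w (φ t)) x ((1 / φ x + 48 / φ x ^ 2 - 2 * w / φ x ^ 3) * a)
      ((-1 / φ x ^ 2 - 96 / φ x ^ 3 + 6 * w / φ x ^ 4) * a ^ 2 +
        (1 / φ x + 48 / φ x ^ 2 - 2 * w / φ x ^ 3) * b) :=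
  h.comp (G' := fun s => 1 / s + 48 / s ^ 2 - 2 * w / s ^ 3)
    (by filter_upwards [lt_mem_nhds hp] with s hs using Gb_d1 w hs) (Gb_d2 w hp)

lemma J2.Gbz (z q : ℝ) : J2 (fun t => _root_.Gb (Real.cosh (√2 * t)) q) z
    (√2 * Real.sinh (√2 * z) / q ^ 2) (2 * Real.cosh (√2 * z) / q ^ 2) := by
  have hr : √2 ^ 2 = 2 := Real.sq_sqrt (by norm_num)
  have hd : ∀ t, HasDerivAt (fun t : ℝ => √2 * t) √2 t := fun t => by
    simpa using (hasDerivAt_id t).const_mul √2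
  refine J2.of (φ' := fun t => √2 * Real.sinh (√2 * t) / q ^ 2) (fun t => ?_) ?_
  · refine (((hd t).cosh.div_const (q ^ 2)).const_add (Real.log q + 2 - 48 / q)).congr_deriv ?_
    ring
  · refine (((hd z).sinh.const_mul √2).div_const (q ^ 2)).congr_deriv ?_
    calc √2 * (Real.cosh (√2 * z) * √2) / q ^ 2
        = √2 ^ 2 * Real.cosh (√2 * z) / q ^ 2 := by ring
      _ = _ := by rw [hr]

lemma abs_le_cosh (z : ℝ) : |z| ≤ 2 * Real.cosh (√2 * z) := by
  have hr : 1 ≤ √2 := by rw [Real.one_le_sqrt]; norm_num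
  rw [← Real.cosh_abs, Real.cosh_eq, abs_mul, abs_of_nonneg (by linarith : 0 ≤ √2)]
  have := Real.add_one_le_exp (√2 * |z|)
  have := Real.exp_pos (-(√2 * |z|))
  have := abs_nonneg z
  nlinarith

set_option maxHeartbeats 2000000 in
lemma core {U : ℝ × ℝ × ℝ → ℝ} (h : Sol U) (hlt : ∀ p, U p < 1)
    (hN1 : ∀ p, Nf U p ≤ 1) (hsup : ∀ δ > 0, ∃ p, 1 - δ < Nf U p) :
    ∃ p, Nf U p = 1 := by
  by_contra hno
  push Not at hno
  have hNlt : ∀ p, Nf U p < 1 := fun p => lt_of_le_of_ne (hN1 p) (hno p)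
  have hge : ∀ p, -1 ≤ U p := fun p => by linarith [h.neg.le_one p]
  have hNc := Nf_cont h hlt
  -- the compact set
  let K : Set (ℝ × ℝ × ℝ) := {p | p.1 ^ 2 + p.2.1 ^ 2 + 24 ≤ 101} ∩ {p | Real.cosh (√2 * p.2.2) ≤ 400}
  have hKclosed : IsClosed K := by
    refine (isClosed_le (by fun_prop) continuous_const).inter
      (isClosed_le ?_ continuous_const)
    exact Real.continuous_cosh.comp (by fun_prop)
  have hK : IsCompact K := by
    refine (isCompact_closedBall (0 : ℝ × ℝ × ℝ) 800).of_isClosed_subset hKclosed ?_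
    rintro ⟨x, y, z⟩ ⟨h1, h2⟩
    simp only [Set.mem_ofPred_eq] at h1 h2
    have e1 : |x| ≤ 800 := (abs_le_of_sq_le (K := 77) (by nlinarith [sq_nonneg y])).trans (by norm_num)
    have e2 : |y| ≤ 800 := (abs_le_of_sq_le (K := 77) (by nlinarith [sq_nonneg x])).trans (by norm_num)
    have e3 : |z| ≤ 800 := (abs_le_cosh z).trans (by linarith)
    simp [Metric.mem_closedBall, e1, e2, e3]
  have hKne : K.Nonempty := ⟨(0, 0, 0), by simp [K]; norm_num⟩
  obtain ⟨pk, hpk, hkmax⟩ := hK.exists_isMaxOn hKne hNc.continuousOn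
  set m := min (1 - Nf U pk) (1 / 16) with hm
  have hmp : 0 < m := lt_min (by linarith [hNlt pk]) (by norm_num)
  have hm1 : m ≤ 1 - Nf U pk := min_le_left _ _
  have hm2 : m ≤ 1 / 16 := min_le_right _ _
  obtain ⟨p0, hp0⟩ := hsup m hmp
  let V : ℝ × ℝ × ℝ → ℝ := fun p => Gb (Real.cosh (√2 * p.2.2)) (p.1 ^ 2 + p.2.1 ^ 2 + 24)
  have hq24 : ∀ x y : ℝ, 24 ≤ x ^ 2 + y ^ 2 + 24 := fun x y => by nlinarith [sq_nonneg x, sq_nonneg y]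
  have hVc : Continuous V := by
    have hne : ∀ p : ℝ × ℝ × ℝ, p.1 ^ 2 + p.2.1 ^ 2 + 24 ≠ 0 := fun p => by
      linarith [hq24 p.1 p.2.1]
    have hcc : Continuous fun p : ℝ × ℝ × ℝ => Real.cosh (√2 * p.2.2) :=
      Real.continuous_cosh.comp (by fun_prop)
    have hqc : Continuous fun p : ℝ × ℝ × ℝ => p.1 ^ 2 + p.2.1 ^ 2 + 24 := by fun_prop
    exact (((hqc.log hne).add continuous_const).sub (continuous_const.div hqc hne)).add
      (hcc.div (hqc.pow 2) (fun p => pow_ne_zero 2 (hne p)))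
  have hVlow : ∀ w s : ℝ, 0 ≤ w → 24 ≤ s → Real.log s ≤ Gb w s ∧ w / s ^ 2 ≤ Gb w s := by
    intro w s hw hs
    have h1 : 48 / s ≤ 2 := by rw [div_le_iff₀ (by linarith)]; linarith
    have h2 : 0 ≤ Real.log s := Real.log_nonneg (by linarith)
    have h3 : 0 ≤ w / s ^ 2 := by positivity
    unfold Gb
    constructor <;> linarith
  have hcpos : ∀ t : ℝ, 0 ≤ Real.cosh t := fun t => (Real.cosh_pos t).le
  have hV0 : 0 ≤ V p0 := (Real.log_nonneg (by linarith [hq24 p0.1 p0.2.1])).trans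
    (hVlow _ _ (hcpos _) (hq24 p0.1 p0.2.1)).1
  set d := Nf U p0 - (1 - m) with hd
  have hdp : 0 < d := by linarith
  set ε := d / (2 * (V p0 + 1)) with hε
  have hεp : 0 < ε := by positivity
  have hεV : ε * V p0 < d := by
    have : ε * (V p0 + 1) = d / 2 := by rw [hε]; field_simp
    nlinarith
  let F : ℝ × ℝ × ℝ → ℝ := fun p => (Nf U p + (-ε) * V p) + (-(1 - m))
  have hFc : Continuous F := by fun_prop
  set T := 1 / ε with hT
  have hTp : 0 < T := by positivity
  obtain ⟨x, y, z, -, hpp, hmax⟩ := exists_max_on (F := F) (C := Set.univ) isClosed_univ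
    hFc.continuousOn (R := Real.exp T + 1 + 2 * (T * Real.exp T ^ 2)) (by
      rintro x y z - hp
      simp only [F] at hp
      have h1 := hN1 (x, y, z)
      have h2 : V (x, y, z) ≤ T := by
        rw [hT, le_div_iff₀ hεp]; linarith
      obtain ⟨h3, h4⟩ := hVlow (Real.cosh (√2 * z)) _ (hcpos _) (hq24 x y)
      have hq := hq24 x y
      have hx := sq_nonneg x
      have hy := sq_nonneg y
      set q := x ^ 2 + y ^ 2 + 24 with hqd
      have h5 : q ≤ Real.exp T := by
        rw [← Real.log_le_iff_le_exp (by linarith)]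
        exact h3.trans h2
      have h6 : Real.cosh (√2 * z) ≤ T * q ^ 2 := by
        rw [← div_le_iff₀ (by positivity)]
        exact h4.trans h2
      have h7 : T * q ^ 2 ≤ T * Real.exp T ^ 2 := by gcongr
      have h8 := abs_le_cosh z
      have h9 : 0 < T * Real.exp T ^ 2 := by positivity
      have h10 := Real.exp_pos T
      have e1 : |x| ≤ Real.exp T + 1 := abs_le_of_sq_le (by linarith)
      have e2 : |y| ≤ Real.exp T + 1 := abs_le_of_sq_le (by linarith)
      refine ⟨?_, ?_, ?_⟩ <;> linarith) (p0 := p0) (Set.mem_univ _) (by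
      simp only [F]; linarith)
  have hloc : IsLocalMax F (x, y, z) := Eventually.of_forall fun q => hmax q (Set.mem_univ q)
  have hq := hq24 x y
  obtain ⟨h3, -⟩ := hVlow (Real.cosh (√2 * z)) _ (hcpos _) hq
  have hVp : 0 ≤ V (x, y, z) := (Real.log_nonneg (by linarith)).trans h3
  have hNbig : 1 - m < Nf U (x, y, z) := by
    simp only [F] at hpp
    nlinarith
  have hnK : (x, y, z) ∉ K := by
    intro hin
    have : Nf U (x, y, z) ≤ Nf U pk := hkmax hin
    linarith
  have hout : 101 < x ^ 2 + y ^ 2 + 24 ∨ 400 < Real.cosh (√2 * z) := by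
    by_contra hcc
    push Not at hcc
    exact hnK hcc
  obtain ⟨a1, b1, a2, b2, a3, b3, h1, h2, h3, he⟩ := Nf_pde h hlt x y z
  have hq0 : 0 < x ^ 2 + y ^ 2 + 24 := by linarith
  have k1 := (h1.add (((((J2.sq' x).add (J2.const (y ^ 2) x)).add (J2.const 24 x)).Gb
    (Real.cosh (√2 * z)) hq0).constMul (-ε))).add (J2.const (-(1 - m)) x)
  have k2 := (h2.add (((((J2.const (x ^ 2) y).add (J2.sq' y)).add (J2.const 24 y)).Gb
    (Real.cosh (√2 * z)) hq0).constMul (-ε))).add (J2.const (-(1 - m)) y)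
  have k3 := (h3.add ((J2.Gbz z (x ^ 2 + y ^ 2 + 24)).constMul (-ε))).add (J2.const (-(1 - m)) z)
  obtain ⟨-, -, e3, e4⟩ := max3 hloc k1 k2 k3
  have hs : x ^ 2 + y ^ 2 = (x ^ 2 + y ^ 2 + 24) - 24 := by ring
  set q := x ^ 2 + y ^ 2 + 24 with hqd
  set W := Real.cosh (√2 * z) with hW
  set S := Real.sinh (√2 * z) with hS
  -- bound on u
  have hkey : 7 / 2 * W - 4 ≤ 4 * (U (x, y, z) * S) := by
    set Y := Real.exp (√2 * z) with hY
    have hYp : 0 < Y := Real.exp_pos _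
    have hYi : Real.exp (-(√2 * z)) = Y⁻¹ := Real.exp_neg _
    have hWY : W = (Y + Y⁻¹) / 2 := by rw [hW, Real.cosh_eq, hYi]
    have hSY : S = (Y - Y⁻¹) / 2 := by rw [hS, Real.sinh_eq, hYi]
    have hv := hlt (x, y, z)
    have hNle := hN1 (x, y, z)
    have hNY : Nf U (x, y, z) * Y * (1 - U (x, y, z)) = 1 + U (x, y, z) := by
      have hne : 1 - U (x, y, z) ≠ 0 := by linarith
      have h5 : Real.exp (-√2 * z) * Y = 1 := by
        rw [hY, ← Real.exp_add]; simp
      simp only [Nf]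
      calc _ = (Real.exp (-√2 * z) * Y) * ((1 + U (x, y, z)) / (1 - U (x, y, z)) * (1 - U (x, y, z))) := by ring
        _ = _ := by rw [h5, div_mul_cancel₀ _ hne, one_mul]
    set N := Nf U (x, y, z) with hN
    have hNp : 15 / 16 ≤ N := by linarith
    have huv : U (x, y, z) = (N * Y - 1) / (N * Y + 1) := by
      rw [eq_div_iff (by positivity)]; linarith
    have hpoly : (7 / 4 * (Y ^ 2 + 1) - 4 * Y) * (N * Y + 1) ≤ 2 * (N * Y - 1) * (Y ^ 2 - 1) := by
      have : 2 * (N * Y - 1) * (Y ^ 2 - 1) - (7 / 4 * (Y ^ 2 + 1) - 4 * Y) * (N * Y + 1)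
        = (Y + 1) * (Y ^ 2 + 1) / 4 - (1 - N) * (Y * (Y ^ 2 / 4 + 4 * Y)) + (1 - N) * (Y * (15 / 4)) := by ring
      have h5 : (1 - N) * (Y * (Y ^ 2 / 4 + 4 * Y)) ≤ 1 / 16 * (Y * (Y ^ 2 / 4 + 4 * Y)) := by
        apply mul_le_mul_of_nonneg_right (by linarith); positivity
      have h6 : 0 ≤ (1 - N) * (Y * (15 / 4)) := by
        apply mul_nonneg (by linarith); positivity
      have h7 : 0 < Y ^ 3 := by positivity
      nlinarith
    have hden : 0 < Y * (N * Y + 1) := by positivity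
    rw [← sub_nonneg]
    have : 4 * (U (x, y, z) * S) - (7 / 2 * W - 4) =
      (2 * (N * Y - 1) * (Y ^ 2 - 1) - (7 / 4 * (Y ^ 2 + 1) - 4 * Y) * (N * Y + 1)) / (Y * (N * Y + 1)) := by
      rw [huv, hWY, hSY]
      field_simp
      ring
    rw [this]
    exact div_nonneg (by linarith) hden.le
  have hr : √2 ^ 2 = 2 := Real.sq_sqrt (by norm_num)
  have ha3 : a3 = ε * (√2 * S / q ^ 2) := by linarith
  have hb : b1 + b2 + b3 ≤ ε * ((-1 / q ^ 2 - 96 / q ^ 3 + 6 * W / q ^ 4) * (4 * (q - 24)) +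
      4 * (1 / q + 48 / q ^ 2 - 2 * W / q ^ 3) + 2 * W / q ^ 2) := by
    rw [← hs]; linarith
  have hl : 2 * √2 * U (x, y, z) * a3 = ε * (4 * (U (x, y, z) * S) / q ^ 2) := by
    rw [ha3]
    calc _ = ε * (2 * √2 ^ 2 * (U (x, y, z) * S) / q ^ 2) := by ring
      _ = _ := by rw [hr]; ring
  have hfin := le_of_mul_le_mul_left (hl.symm.le.trans (he.trans hb)) hεp
  have hfin2 : 4 * (U (x, y, z) * S) ≤ -96 + 9216 / q + W * (16 / q - 576 / q ^ 2) + 2 * W := by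
    rw [div_le_iff₀ (by positivity)] at hfin
    refine hfin.trans_eq ?_
    field_simp
    ring
  have hW1 : 1 ≤ W := Real.one_le_cosh _
  have hi1 : 16 / q ≤ 2 / 3 := by rw [div_le_iff₀ hq0]; linarith
  have hi2 : 0 ≤ 576 / q ^ 2 := by positivity
  have h9 : W * (16 / q - 576 / q ^ 2) ≤ W * (2 / 3) := by
    apply mul_le_mul_of_nonneg_left (by linarith); linarith
  rcases hout with ho | ho
  · have : 9216 / q ≤ 92 := by rw [div_le_iff₀ hq0]; linarith
    linarith
  · have : 9216 / q ≤ 384 := by rw [div_le_iff₀ hq0]; linarith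
    linarith

lemma J2.shift {φ : ℝ → ℝ} {x a b τ : ℝ} (h : J2 φ (x + τ) a b) :
    J2 (fun t => φ (t + τ)) x a b := by
  obtain ⟨f, hf, rfl, hf2⟩ := h
  refine ⟨fun t => f (t + τ), ?_, rfl, hf2.comp_add_const x τ⟩
  have hc : ContinuousAt (fun t : ℝ => t + τ) x := by fun_prop
  filter_upwards [hc.eventually hf] with t ht using ht.comp_add_const t τ

lemma Sol.shift {U : ℝ × ℝ × ℝ → ℝ} (h : Sol U) (τ : ℝ) :
    Sol (fun p => U (p.1, p.2.1, p.2.2 + τ)) := by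
  refine ⟨by have := h.cont; fun_prop, fun x y z => ?_⟩
  obtain ⟨a1, b1, a2, b2, a3, b3, h1, h2, h3, he⟩ := h.pde x y (z + τ)
  exact ⟨a1, b1, a2, b2, a3, b3, h1, h2, h3.shift, he⟩

lemma rigid {U : ℝ × ℝ × ℝ → ℝ} (h : Sol U) (hlt : ∀ p, U p < 1)
    (hN1 : ∀ p, Nf U p ≤ 1) (hsup : ∀ δ > 0, ∃ p, 1 - δ < Nf U p) (x y z : ℝ) :
    U (x, y, z) = Real.tanh (z / √2) := by
  obtain ⟨p0, hp0⟩ := core h hlt hN1 hsup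
  have hN := strong_max (Nf_cont h hlt) hN1
    (fun p => abs_le.2 ⟨by linarith [h.neg.le_one p], (hlt p).le⟩) (Nf_pde h hlt) p0 hp0 (x, y, z)
  have hv := hlt (x, y, z)
  simp only [Nf] at hN
  have hne : 1 - U (x, y, z) ≠ 0 := by linarith
  have hr : √2 ^ 2 = 2 := Real.sq_sqrt (by norm_num)
  have hr0 : 0 < √2 := by positivity
  rw [Real.tanh_eq_sinh_div_cosh, Real.sinh_eq, Real.cosh_eq]
  set e := Real.exp (z / √2) with he
  have hep : 0 < e := Real.exp_pos _
  have he2 : Real.exp (-(z / √2)) = e⁻¹ := Real.exp_neg _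
  have he3 : Real.exp (-√2 * z) = (e ^ 2)⁻¹ := by
    rw [he, ← Real.exp_nat_mul, ← Real.exp_neg]
    congr 1
    field_simp
    rw [hr]; push_cast; ring
  rw [he3] at hN
  rw [he2]
  field_simp at hN
  field_simp
  linarith

lemma main3 {U : ℝ × ℝ × ℝ → ℝ} (h : Sol U) (hneg : ∀ x y z, z ≤ 0 → U (x, y, z) < 0)
    (hnc : ¬ ∃ c, ∀ p, U p = c) :
    ∃ a : ℝ, ∀ x y z, U (x, y, z) = Real.tanh ((z + a) / √2) := by
  have hge : ∀ p, -1 ≤ U p := fun p => by linarith [h.neg.le_one p]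
  have hlt : ∀ p, U p < 1 := by
    rintro ⟨x, y, z⟩
    rcases le_total z 0 with hz | hz
    · linarith [hneg x y z hz]
    · have := h.one_sub hneg x y z hz
      have := Real.exp_pos (-√2 * z)
      linarith
  have hr0 : 0 < √2 := by positivity
  have hbdd : ∀ p, Nf U p ≤ Real.exp (-√2 * (-7)) + 2 := by
    rintro ⟨x, y, z⟩
    have hB := Real.exp_pos (-√2 * (-7))
    have hv := hlt (x, y, z)
    rcases le_total z 0 with hz | hz
    · rcases le_total z (-7) with hz7 | hz7
      · linarith [Nf_low h hlt hneg x y z hz7]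
      · have h1 := hneg x y z hz
        have h2 : (1 + U (x, y, z)) / (1 - U (x, y, z)) ≤ 1 := by
          rw [div_le_one (by linarith)]; linarith
        have h3 : Nf U (x, y, z) ≤ Real.exp (-√2 * z) :=
          mul_le_of_le_one_right (Real.exp_pos _).le h2
        have h4 : Real.exp (-√2 * z) ≤ Real.exp (-√2 * (-7)) := by
          rw [Real.exp_le_exp]; nlinarith
        linarith
    · have h1 := h.one_sub hneg x y z hz
      have h2 : Nf U (x, y, z) ≤ 2 := by
        simp only [Nf]
        rw [mul_div_assoc', div_le_iff₀ (by linarith)]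
        have := Real.exp_pos (-√2 * z)
        nlinarith
      linarith
  have hN0 : ∀ p, 0 ≤ Nf U p := fun p =>
    mul_nonneg (Real.exp_pos _).le (div_nonneg (by linarith [hge p]) (by linarith [hlt p]))
  set c := sSup (Set.range (Nf U)) with hc
  have hBA : BddAbove (Set.range (Nf U)) := ⟨_, by rintro _ ⟨p, rfl⟩; exact hbdd p⟩
  have hle : ∀ p, Nf U p ≤ c := fun p => le_csSup hBA ⟨p, rfl⟩
  have hcp : 0 < c := by
    by_contra hcn
    push Not at hcn
    refine hnc ⟨-1, fun p => ?_⟩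
    have h0 : Nf U p = 0 := le_antisymm ((hle p).trans hcn) (hN0 p)
    simp only [Nf] at h0
    have h1 := (mul_eq_zero.1 h0).resolve_left (Real.exp_pos _).ne'
    have h2 := (div_eq_zero_iff.1 h1).resolve_right (by linarith [hlt p])
    linarith
  set τ := -Real.log c / √2 with hτ
  have hNs : ∀ p, Nf (fun p => U (p.1, p.2.1, p.2.2 + τ)) p = Nf U (p.1, p.2.1, p.2.2 + τ) / c := by
    intro p
    simp only [Nf]
    have h1 : Real.exp (-√2 * (p.2.2 + τ)) = Real.exp (-√2 * p.2.2) * c := by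
      have : -√2 * (p.2.2 + τ) = -√2 * p.2.2 + Real.log c := by
        rw [hτ]; field_simp; ring
      rw [this, Real.exp_add, Real.exp_log hcp]
    rw [h1]
    field_simp
  have hrig := rigid (h.shift τ) (fun p => hlt _) (fun p => by
    rw [hNs, div_le_one hcp]; exact hle _) (fun δ hδ => by
    have hlt' : c * (1 - δ) < c := by nlinarith
    obtain ⟨_, ⟨p, rfl⟩, hp⟩ := exists_lt_of_lt_csSup (Set.range_nonempty (Nf U)) hlt'
    refine ⟨(p.1, p.2.1, p.2.2 - τ), ?_⟩
    rw [hNs, lt_div_iff₀ hcp]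
    simp only [sub_add_cancel]
    linarith)
  refine ⟨-τ, fun x y z => ?_⟩
  have := hrig x y (z + -τ)
  simpa using this

lemma J2.line {n : ℕ} {u : EuclideanSpace ℝ (Fin n) → ℝ} (hu : ContDiff ℝ 2 u)
    (b : EuclideanSpace ℝ (Fin n)) (i : Fin n) (t : ℝ) :
    J2 (fun t => u (b + t • EuclideanSpace.single i 1)) t
      (fderiv ℝ u (b + t • EuclideanSpace.single i 1) (EuclideanSpace.single i 1))
      (fderiv ℝ (fun y => fderiv ℝ u y (EuclideanSpace.single i 1))
        (b + t • EuclideanSpace.single i 1) (EuclideanSpace.single i 1)) := by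
  have hl : ∀ t : ℝ, HasDerivAt (fun t : ℝ => b + t • (EuclideanSpace.single i (1 : ℝ)))
      (EuclideanSpace.single i 1) t := fun t => by
    simpa using ((hasDerivAt_id t).smul_const (EuclideanSpace.single i (1 : ℝ))).const_add b
  have hd : Differentiable ℝ u := hu.differentiable (by norm_num)
  have hd2 : Differentiable ℝ (fun y => fderiv ℝ u y (EuclideanSpace.single i 1)) := by
    have h1 : ContDiff ℝ 1 (fderiv ℝ u) := hu.fderiv_right (by norm_num)
    exact (h1.clm_apply contDiff_const).differentiable (by norm_num)
  refine J2.of (φ' := fun t => fderiv ℝ u (b + t • EuclideanSpace.single i 1)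
    (EuclideanSpace.single i 1)) (fun s => ?_) ?_
  · exact (hd _).hasFDerivAt.comp_hasDerivAt s (hl s)
  · exact (hd2 _).hasFDerivAt.comp_hasDerivAt t (hl t)

lemma transfer {n : ℕ} (u : EuclideanSpace ℝ (Fin n) → ℝ) (k : Fin n)
    (hnc : ¬ ∃ c : ℝ, ∀ x, u x = c)
    (hlevel : ∀ x, u x = 0 → 0 < x k)
    (emb : ℝ × ℝ × ℝ → EuclideanSpace ℝ (Fin n)) (hS : Sol (fun p => u (emb p)))
    (hk : ∀ p, emb p k = p.2.2) (hsurj : ∀ x, ∃ p, emb p = x) :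
    ∃ a : ℝ, (∀ x, u x = H (-(x k) + a)) ∨ (∀ x, u x = H (x k + a)) := by
  have hnc' : ∀ s : ℝ, s ≠ 0 → ¬ ∃ c, ∀ p, s * u (emb p) = c := by
    rintro s hs ⟨c, hc⟩
    refine hnc ⟨c / s, fun x => ?_⟩
    obtain ⟨p, rfl⟩ := hsurj x
    rw [← hc p]; field_simp
  have hne : ∀ p : ℝ × ℝ × ℝ, p.2.2 ≤ 0 → u (emb p) ≠ 0 := fun p hp h0 => by
    have := hlevel _ h0
    rw [hk] at this
    linarith
  have hpre : IsPreconnected {p : ℝ × ℝ × ℝ | p.2.2 ≤ 0} := by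
    apply Convex.isPreconnected
    intro p hp q hq a b ha hb _
    simp only [Set.mem_ofPred_eq] at hp hq ⊢
    simp only [Prod.snd_add, Prod.smul_snd, smul_eq_mul]
    nlinarith
  have hsign : (∀ p : ℝ × ℝ × ℝ, p.2.2 ≤ 0 → u (emb p) < 0) ∨
      (∀ p : ℝ × ℝ × ℝ, p.2.2 ≤ 0 → 0 < u (emb p)) := by
    by_contra hcon
    push Not at hcon
    obtain ⟨⟨p, hp, hp2⟩, ⟨q, hq, hq2⟩⟩ := hcon
    obtain ⟨r, hr, hr2⟩ := hpre.intermediate_value (a := q) (b := p) hq hp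
      hS.cont.continuousOn (show (0 : ℝ) ∈ Set.Icc _ _ from ⟨hq2, hp2⟩)
    exact hne r hr hr2
  rcases hsign with hs | hs
  · obtain ⟨a, ha⟩ := main3 hS (fun x y z hz => hs (x, y, z) hz) (by simpa using hnc' 1 one_ne_zero)
    refine ⟨a, Or.inr fun x => ?_⟩
    obtain ⟨p, rfl⟩ := hsurj x
    rw [hk]
    exact ha p.1 p.2.1 p.2.2
  · obtain ⟨a, ha⟩ := main3 hS.neg (fun x y z hz => by
      have := hs (x, y, z) hz; linarith) (by simpa using hnc' (-1) (by norm_num))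
    refine ⟨-a, Or.inl fun x => ?_⟩
    obtain ⟨p, rfl⟩ := hsurj x
    rw [hk]
    have h1 := ha p.1 p.2.1 p.2.2
    have h2 : u (emb p) = - Real.tanh ((p.2.2 + a) / √2) := by
      rw [← h1]; simp
    rw [h2, H, ← Real.tanh_neg]
    congr 1
    ring

theorem weak_half_space {n : ℕ} (hn1 : 1 ≤ n) (hn3 : n ≤ 3)
    (u : EuclideanSpace ℝ (Fin n) → ℝ)
    (hu : IsACSolution u) (hnc : ¬ ∃ c : ℝ, ∀ x, u x = c)
    (hlevel : {x : EuclideanSpace ℝ (Fin n) | u x = 0} ⊆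
      {x : EuclideanSpace ℝ (Fin n) | 0 < x ⟨n - 1, by omega⟩}) :
    ∃ a : ℝ,
      (∀ x : EuclideanSpace ℝ (Fin n), u x = H (-(x ⟨n - 1, by omega⟩) + a)) ∨
      (∀ x : EuclideanSpace ℝ (Fin n), u x = H (x ⟨n - 1, by omega⟩ + a)) := by
  obtain ⟨hC, hE⟩ := hu
  have hlev : ∀ x, u x = 0 → 0 < x ⟨n - 1, by omega⟩ := fun x hx => hlevel hx
  have hlap : ∀ x, laplacian u x = u x ^ 3 - u x := fun x => by linarith [hE x]
  have hcu := hC.continuous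
  unfold laplacian at hlap
  clear hE hlevel
  obtain rfl | rfl | rfl : n = 1 ∨ n = 2 ∨ n = 3 := by omega
  · refine transfer u _ hnc hlev (fun p => !₂[p.2.2]) ⟨by fun_prop, fun x y z => ?_⟩
      (fun p => by simp) (fun x => ⟨(0, 0, x 0), by ext i; fin_cases i; simp⟩)
    have e0 : ∀ t : ℝ, (!₂[t] : EuclideanSpace ℝ (Fin 1)) = 0 + t • EuclideanSpace.single 0 1 := by
      intro t; ext i; fin_cases i; simp
    have h0 := J2.line hC 0 (0 : Fin 1) z
    simp only [← e0] at h0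
    have := hlap !₂[z]
    simp only [Fin.sum_univ_one] at this
    refine ⟨_, _, _, _, _, _, J2.const (u !₂[z]) x, J2.const (u !₂[z]) y, h0, ?_⟩
    rw [← this]; ring
  · refine transfer u _ hnc hlev (fun p => !₂[p.2.1, p.2.2]) ⟨by fun_prop, fun x y z => ?_⟩
      (fun p => by simp) (fun x => ⟨(0, x 0, x 1), by ext i; fin_cases i <;> simp⟩)
    have e0 : ∀ t : ℝ, (!₂[t, z] : EuclideanSpace ℝ (Fin 2)) =
        !₂[0, z] + t • EuclideanSpace.single 0 1 := by
      intro t; ext i; fin_cases i <;> simp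
    have e1 : ∀ t : ℝ, (!₂[y, t] : EuclideanSpace ℝ (Fin 2)) =
        !₂[y, 0] + t • EuclideanSpace.single 1 1 := by
      intro t; ext i; fin_cases i <;> simp
    have h0 := J2.line hC !₂[0, z] (0 : Fin 2) y
    have h1 := J2.line hC !₂[y, 0] (1 : Fin 2) z
    simp only [← e0] at h0
    simp only [← e1] at h1
    have := hlap !₂[y, z]
    simp only [Fin.sum_univ_two] at this
    refine ⟨_, _, _, _, _, _, J2.const (u !₂[y, z]) x, h0, h1, ?_⟩
    rw [← this]; ring
  · refine transfer u _ hnc hlev (fun p => !₂[p.1, p.2.1, p.2.2]) ⟨by fun_prop, fun x y z => ?_⟩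
      (fun p => by simp) (fun x => ⟨(x 0, x 1, x 2), by ext i; fin_cases i <;> simp⟩)
    have e0 : ∀ t : ℝ, (!₂[t, y, z] : EuclideanSpace ℝ (Fin 3)) =
        !₂[0, y, z] + t • EuclideanSpace.single 0 1 := by
      intro t; ext i; fin_cases i <;> simp
    have e1 : ∀ t : ℝ, (!₂[x, t, z] : EuclideanSpace ℝ (Fin 3)) =
        !₂[x, 0, z] + t • EuclideanSpace.single 1 1 := by
      intro t; ext i; fin_cases i <;> simp
    have e2 : ∀ t : ℝ, (!₂[x, y, t] : EuclideanSpace ℝ (Fin 3)) =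
        !₂[x, y, 0] + t • EuclideanSpace.single 2 1 := by
      intro t; ext i; fin_cases i <;> simp
    have h0 := J2.line hC !₂[0, y, z] (0 : Fin 3) x
    have h1 := J2.line hC !₂[x, 0, z] (1 : Fin 3) y
    have h2 := J2.line hC !₂[x, y, 0] (2 : Fin 3) z
    simp only [← e0] at h0
    simp only [← e1] at h1
    simp only [← e2] at h2
    have := hlap !₂[x, y, z]
    simp only [Fin.sum_univ_three] at this
    exact ⟨_, _, _, _, _, _, h0, h1, h2, by rw [← this]⟩
end

section
/- Let u₁ < u₂ (pointwise strict inequality everywhere) be two non-constant solutions of the Allen–Cahn equation −Δu = u − u³ on ℝ². Then u₁ and u₂ are one-dimensional: there exist a unit vector e ∈ ℝ² and real numbers a < b such that u₁(x) = H(x·e + a) and u₂(x) = H(x·e + b) for all x ∈ ℝ². -/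
open scoped RealInnerProductSpace

open Real Set Filter Topology

/-- The plane. -/
abbrev E2 := EuclideanSpace ℝ (Fin 2)

/-- Partial derivative. -/
noncomputable def pd (i : Fin 2) (f : E2 → ℝ) (x : E2) : ℝ :=
  fderiv ℝ f x (EuclideanSpace.single i 1)

lemma laplacian_eq (f : E2 → ℝ) (x : E2) :
    laplacian f x = pd 0 (pd 0 f) x + pd 1 (pd 1 f) x := by
  simp only [laplacian, Fin.sum_univ_two]
  rfl

lemma pd_contDiff {f : E2 → ℝ} {n m : ℕ∞} (hf : ContDiff ℝ n f) (h : m + 1 ≤ n) (i : Fin 2) :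
    ContDiff ℝ m (pd i f) := by
  unfold pd
  have : ContDiff ℝ m (fderiv ℝ f) := hf.fderiv_right (by exact_mod_cast h)
  exact this.clm_apply contDiff_const

lemma pd_contDiff1 {f : E2 → ℝ} (hf : ContDiff ℝ 2 f) (i : Fin 2) : ContDiff ℝ 1 (pd i f) :=
  pd_contDiff (n := 2) (m := 1) hf (by norm_num [one_add_one_eq_two]) i

lemma pd_continuous {f : E2 → ℝ} (hf : ContDiff ℝ 1 f) (i : Fin 2) : Continuous (pd i f) :=
  (pd_contDiff (n := 1) (m := 0) hf (by norm_num) i).continuous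

lemma dat {f : E2 → ℝ} {n : WithTop ℕ∞} (hf : ContDiff ℝ n f) (hn : n ≠ 0) (x : E2) :
    DifferentiableAt ℝ f x := (hf.differentiable hn) x

lemma pd_add {f g : E2 → ℝ} {x : E2} (hf : DifferentiableAt ℝ f x) (hg : DifferentiableAt ℝ g x)
    (i : Fin 2) : pd i (fun y => f y + g y) x = pd i f x + pd i g x := by
  simp [pd, fderiv_fun_add hf hg]

lemma pd_sub {f g : E2 → ℝ} {x : E2} (hf : DifferentiableAt ℝ f x) (hg : DifferentiableAt ℝ g x)
    (i : Fin 2) : pd i (fun y => f y - g y) x = pd i f x - pd i g x := by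
  simp [pd, fderiv_fun_sub hf hg]

lemma pd_neg {f : E2 → ℝ} (x : E2) (i : Fin 2) : pd i (fun y => - f y) x = - pd i f x := by
  simp [pd]

lemma pd_mul {f g : E2 → ℝ} {x : E2} (hf : DifferentiableAt ℝ f x) (hg : DifferentiableAt ℝ g x)
    (i : Fin 2) : pd i (fun y => f y * g y) x = pd i f x * g x + f x * pd i g x := by
  simp [pd, fderiv_fun_mul hf hg]; ring

lemma pd_const (c : ℝ) (x : E2) (i : Fin 2) : pd i (fun _ => c) x = 0 := by
  simp [pd]

lemma pd_comp {f : E2 → ℝ} {x : E2} {g : ℝ → ℝ} {g' : ℝ} (hg : HasDerivAt g g' (f x))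
    (hf : DifferentiableAt ℝ f x) (i : Fin 2) : pd i (fun y => g (f y)) x = g' * pd i f x := by
  have := (hg.comp_hasFDerivAt x hf.hasFDerivAt).fderiv
  unfold pd
  rw [show (fun y => g (f y)) = g ∘ f from rfl, this]
  simp

lemma pd_comp_sub (f : E2 → ℝ) (h x : E2) (i : Fin 2) :
    pd i (fun y => f (y - h)) x = pd i f (x - h) := by
  simp [pd, fderiv_comp_sub]

/-- squared distance to c -/
noncomputable def nsq (c : E2) (x : E2) : ℝ := (x 0 - c 0) ^ 2 + (x 1 - c 1) ^ 2

lemma coord_contDiff (i : Fin 2) {n : WithTop ℕ∞} : ContDiff ℝ n (fun x : E2 => x i) := by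
  fun_prop

lemma nsq_contDiff (c : E2) {n : WithTop ℕ∞} : ContDiff ℝ n (nsq c) := by
  unfold nsq; fun_prop

lemma pd_coord (i j : Fin 2) (x : E2) : pd i (fun y => y j) x = if j = i then 1 else 0 := by
  have : HasFDerivAt (fun y : E2 => y j) (EuclideanSpace.proj j : E2 →L[ℝ] ℝ) x :=
    (EuclideanSpace.proj j : E2 →L[ℝ] ℝ).hasFDerivAt
  unfold pd
  rw [this.fderiv]
  simp

lemma pd_nsq (c x : E2) (i : Fin 2) : pd i (nsq c) x = 2 * (x i - c i) := by
  have hd : ∀ j : Fin 2, DifferentiableAt ℝ (fun y : E2 => y j) x := fun j => by fun_prop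
  have hd' : ∀ j : Fin 2, DifferentiableAt ℝ (fun y : E2 => (y j - c j)^2) x := fun j => by fun_prop
  have h1 : ∀ j : Fin 2, pd i (fun y => (y j - c j)^2) x
      = (2 * (x j - c j)) * (if j = i then 1 else 0) := by
    intro j
    have h : HasDerivAt (fun s : ℝ => (s - c j)^2) (2 * (x j - c j)) (x j) := by
      have := ((hasDerivAt_id' (x j)).sub_const (c j)).fun_pow 2
      simpa using this
    have := pd_comp (g := fun s => (s - c j)^2) h (hd j) i
    rw [this, pd_coord]
  unfold nsq
  rw [pd_add (hd' 0) (hd' 1), h1, h1]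
  fin_cases i <;> simp

lemma pdpd_nsq (c x : E2) (i : Fin 2) : pd i (pd i (nsq c)) x = 2 := by
  have : pd i (nsq c) = fun x => 2 * (x i - c i) := funext fun x => pd_nsq c x i
  rw [this]
  have h : HasDerivAt (fun s : ℝ => 2 * (s - c i)) 2 (x i) := by
    simpa using ((hasDerivAt_id (x i)).sub_const (c i)).const_mul 2
  rw [pd_comp (g := fun s : ℝ => 2 * (s - c i)) h (by fun_prop) i, pd_coord]
  simp

lemma nsq_eq (c x : E2) : nsq c x = ‖x - c‖ ^ 2 := by
  rw [EuclideanSpace.norm_sq_eq]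
  simp [nsq, Fin.sum_univ_two]

lemma pd_eq_zero_of_max {f : E2 → ℝ} {x : E2} (h : IsLocalMax f x) (i : Fin 2) : pd i f x = 0 := by
  simp [pd, h.fderiv_eq_zero]

/-- derivative along a line in coordinate direction -/
lemma line_hasDerivAt {f : E2 → ℝ} (hf : Differentiable ℝ f) (x : E2) (i : Fin 2) (t : ℝ) :
    HasDerivAt (fun s : ℝ => f (x + s • EuclideanSpace.single i (1:ℝ)))
      (pd i f (x + t • EuclideanSpace.single i (1:ℝ))) t := by
  have h1 : HasDerivAt (fun s : ℝ => x + s • EuclideanSpace.single i (1:ℝ))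
      (EuclideanSpace.single i (1:ℝ)) t := by
    simpa using ((hasDerivAt_id t).smul_const (EuclideanSpace.single i (1:ℝ))).const_add x
  exact (hf _).hasFDerivAt.comp_hasDerivAt t h1

lemma pdpd_nonpos_of_max {f : E2 → ℝ} (hf : ContDiff ℝ 2 f) {x : E2} (h : IsLocalMax f x)
    (i : Fin 2) : pd i (pd i f) x ≤ 0 := by
  by_contra hpos
  push Not at hpos
  set φ : ℝ → ℝ := fun s => f (x + s • EuclideanSpace.single i (1:ℝ)) with hφ
  have d1 : ∀ t, HasDerivAt φ (pd i f (x + t • EuclideanSpace.single i (1:ℝ))) t :=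
    line_hasDerivAt (hf.differentiable (by norm_num)) x i
  have e1 : deriv φ = fun t => pd i f (x + t • EuclideanSpace.single i (1:ℝ)) :=
    funext fun t => (d1 t).deriv
  have d2 : HasDerivAt (deriv φ) (pd i (pd i f) x) 0 := by
    rw [e1]
    simpa using line_hasDerivAt ((pd_contDiff1 hf i).differentiable (by norm_num)) x i 0
  have hmin : IsLocalMin φ 0 := by
    apply isLocalMin_of_deriv_deriv_pos
    · rw [d2.deriv]; exact hpos
    · rw [(d1 0).deriv]; simpa using pd_eq_zero_of_max h i
    · exact (d1 0).continuousAt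
  have hmax : IsLocalMax φ 0 := by
    have hc : ContinuousAt (fun s : ℝ => x + s • EuclideanSpace.single i (1:ℝ)) 0 := by fun_prop
    have : Tendsto (fun s : ℝ => x + s • EuclideanSpace.single i (1:ℝ)) (𝓝 0) (𝓝 x) := by
      simpa [ContinuousAt] using hc
    have := this.eventually h
    simpa [IsLocalMax, IsMaxFilter, hφ] using this
  have hconst : φ =ᶠ[𝓝 0] fun _ => φ 0 := by
    filter_upwards [hmin, hmax] with s h1 h2 using le_antisymm h2 h1
  have hd : deriv φ =ᶠ[𝓝 0] fun _ => 0 := by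
    have := hconst.deriv
    simpa using this
  have := hd.deriv_eq
  rw [d2.deriv] at this
  simp at this
  linarith

lemma ko_bound {u : E2 → ℝ} (hu : IsACSolution u) (c : E2) (hc : 0 < u c) (R : ℝ) (hR : 0 < R) :
    R ^ 2 * (u c) ^ 2 ≤ R ^ 2 + 12 := by
  obtain ⟨hC, heq⟩ := hu
  set η : E2 → ℝ := fun x => R ^ 2 - nsq c x with hη
  have hηC : ContDiff ℝ 2 η := contDiff_const.sub (nsq_contDiff c)
  set z : E2 → ℝ := fun x => η x * u x with hz
  have hzC : ContDiff ℝ 2 z := hηC.mul hC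
  obtain ⟨x, hxB, hxmax⟩ := (isCompact_closedBall c R).exists_isMaxOn
    ⟨c, Metric.mem_closedBall_self hR.le⟩ hzC.continuous.continuousOn
  have hzc : z c = R ^ 2 * u c := by simp [hz, hη, nsq]
  have hge : R ^ 2 * u c ≤ z x := by
    rw [← hzc]; exact hxmax (Metric.mem_closedBall_self hR.le)
  have hzpos : 0 < z x := lt_of_lt_of_le (by positivity) hge
  have hn : nsq c x = (dist x c) ^ 2 := by rw [nsq_eq, dist_eq_norm]
  have hdist : dist x c ≤ R := hxB
  have hηnn : 0 ≤ η x := by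
    simp only [hη, hn]; nlinarith [dist_nonneg (x := x) (y := c)]
  have hηpos : 0 < η x := by
    rcases hηnn.lt_or_eq with h | h
    · exact h
    · simp [hz, ← h] at hzpos
  have hupos : 0 < u x := by
    by_contra hneg; push Not at hneg
    have : z x ≤ 0 := mul_nonpos_of_nonneg_of_nonpos hηnn hneg
    linarith
  have hlt : dist x c < R := by
    have : (dist x c) ^ 2 < R ^ 2 := by simp only [hη, hn] at hηpos; linarith
    exact lt_of_pow_lt_pow_left₀ 2 hR.le this
  have hloc : IsLocalMax z x := by
    have : Metric.closedBall c R ∈ 𝓝 x :=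
      mem_of_superset (Metric.isOpen_ball.mem_nhds hlt) Metric.ball_subset_closedBall
    exact hxmax.isLocalMax this
  have hdη : ∀ y, DifferentiableAt ℝ η y := dat hηC (by norm_num)
  have hdu : ∀ y, DifferentiableAt ℝ u y := dat hC (by norm_num)
  have hpη : ∀ i y, pd i η y = - (2 * (y i - c i)) := by
    intro i y
    simp only [hη]
    rw [pd_sub (by fun_prop) (dat (nsq_contDiff c (n := 1)) (by norm_num) y), pd_const, pd_nsq]
    ring
  have hppη : ∀ i y, pd i (pd i η) y = -2 := by
    intro i y
    have : pd i η = fun y => - pd i (nsq c) y := funext fun y => by rw [hpη, pd_nsq]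
    rw [this, pd_neg, pdpd_nsq]
  have hpz : ∀ i, pd i z = fun y => pd i η y * u y + η y * pd i u y :=
    fun i => funext fun y => pd_mul (hdη y) (hdu y) i
  have hppz : ∀ i, pd i (pd i z) x = (-2) * u x + 2 * (pd i η x * pd i u x)
      + η x * pd i (pd i u) x := by
    intro i
    have d1 : DifferentiableAt ℝ (pd i η) x := dat (pd_contDiff1 hηC i) (by norm_num) x
    have d2 : DifferentiableAt ℝ (pd i u) x := dat (pd_contDiff1 hC i) (by norm_num) x
    rw [hpz, pd_add (d1.fun_mul (hdu x)) ((hdη x).fun_mul d2), pd_mul d1 (hdu x), pd_mul (hdη x) d2, hppη]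
    ring
  have g0 : ∀ i, pd i η x * u x + η x * pd i u x = 0 := by
    intro i
    have := pd_eq_zero_of_max hloc i
    rw [hpz] at this; exact this
  have s0 : ∀ i, (-2) * u x + 2 * (pd i η x * pd i u x) + η x * pd i (pd i u) x ≤ 0 := by
    intro i; rw [← hppz]; exact pdpd_nonpos_of_max hzC hloc i
  have hE := heq x
  rw [laplacian_eq] at hE
  have a0 := g0 0
  have a1 := g0 1
  have b0 := s0 0
  have b1 := s0 1
  have hN : (pd 0 η x) ^ 2 + (pd 1 η x) ^ 2 = 4 * nsq c x := by
    rw [hpη, hpη]; simp only [nsq]; ring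
  have hNle : nsq c x ≤ R ^ 2 := by simp only [hη] at hηnn; linarith
  have hηle : η x ≤ R ^ 2 := by
    have : 0 ≤ nsq c x := by unfold nsq; positivity
    simp only [hη]; linarith
  generalize pd 0 η x = p0 at *
  generalize pd 1 η x = p1 at *
  generalize pd 0 u x = q0 at *
  generalize pd 1 u x = q1 at *
  have hzx : z x = η x * u x := rfl
  rw [hzx] at hge
  generalize η x = e at *
  generalize nsq c x = N at *
  have hL : pd 0 (pd 0 u) x + pd 1 (pd 1 u) x = u x ^ 3 - u x := by linarith
  have k1 : (-4) * u x + 2 * (p0 * q0 + p1 * q1) + e * (u x ^ 3 - u x) ≤ 0 := by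
    rw [← hL]; linarith
  have k2 : e * (p0 * q0 + p1 * q1) = - (4 * N) * u x := by
    rw [← hN]; linear_combination p0 * a0 + p1 * a1
  generalize u x = v at *
  have k3 : v * (e ^ 2 * v ^ 2) ≤ v * (e ^ 2 + 4 * e + 8 * N) := by
    have := mul_le_mul_of_nonneg_left k1 hηpos.le
    nlinarith
  have k4 : e ^ 2 * v ^ 2 ≤ e ^ 2 + 4 * e + 8 * N := le_of_mul_le_mul_left k3 hupos
  have k5 : (R ^ 2 * u c) ^ 2 ≤ (e * v) ^ 2 := by
    apply pow_le_pow_left₀ _ hge; positivity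
  have k6 : e ^ 2 ≤ (R ^ 2) ^ 2 := pow_le_pow_left₀ hηpos.le hηle 2
  have k7 : R ^ 2 * (R ^ 2 * u c ^ 2) ≤ R ^ 2 * (R ^ 2 + 12) := by nlinarith
  exact le_of_mul_le_mul_left k7 (by positivity)

lemma u_le_one {u : E2 → ℝ} (hu : IsACSolution u) (c : E2) : u c ≤ 1 := by
  by_contra h
  push Not at h
  have h2 : 0 < (u c) ^ 2 - 1 := by nlinarith
  have := ko_bound hu c (by linarith) (Real.sqrt (13 / ((u c) ^ 2 - 1))) (by positivity)
  rw [Real.sq_sqrt (by positivity)] at this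
  have h3 : 13 / ((u c) ^ 2 - 1) * ((u c) ^ 2 - 1) = 13 := by field_simp
  nlinarith

lemma neg_sol {u : E2 → ℝ} (hu : IsACSolution u) : IsACSolution (fun x => - u x) := by
  refine ⟨hu.1.neg, fun x => ?_⟩
  have := hu.2 x
  rw [laplacian_eq] at this ⊢
  have e : ∀ i, pd i (fun x => - u x) = fun x => - pd i u x := fun i => funext fun x => pd_neg x i
  rw [e, e, pd_neg, pd_neg]
  linear_combination -this

lemma neg_one_le_u {u : E2 → ℝ} (hu : IsACSolution u) (c : E2) : -1 ≤ u c := by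
  have := u_le_one (neg_sol hu) c
  linarith

/-- Rescaled inverse heteroclinic. -/
noncomputable def ga (a s : ℝ) : ℝ := (√2 * a)⁻¹ * (Real.log (a + s) - Real.log (a - s))

lemma ga_hasDerivAt {a s : ℝ} (ha : 0 < a) (h1 : -a < s) (h2 : s < a) :
    HasDerivAt (ga a) (√2 / (a ^ 2 - s ^ 2)) s := by
  have p1 : a + s ≠ 0 := by linarith
  have p2 : a - s ≠ 0 := by linarith
  have e1 : HasDerivAt (fun t => Real.log (a + t)) (1 / (a + s)) s :=
    ((hasDerivAt_id' s).const_add a).log p1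
  have e2 : HasDerivAt (fun t => Real.log (a - t)) (-1 / (a - s)) s :=
    ((hasDerivAt_id' s).const_sub a).log p2
  have := (e1.sub e2).const_mul (√2 * a)⁻¹
  refine this.congr_deriv ?_
  have p3 : a ^ 2 - s ^ 2 ≠ 0 := by
    have : a ^ 2 - s ^ 2 = (a + s) * (a - s) := by ring
    rw [this]; exact mul_ne_zero p1 p2
  have h : (√2) ^ 2 = 2 := Real.sq_sqrt (by norm_num)
  field_simp
  rw [h]; ring

lemma ga_contDiff {u : E2 → ℝ} (hu : ContDiff ℝ 2 u) {a : ℝ}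
    (h1 : ∀ x, -a < u x) (h2 : ∀ x, u x < a) : ContDiff ℝ 2 (fun x => ga a (u x)) := by
  unfold ga
  refine contDiff_const.mul (ContDiff.sub ?_ ?_)
  · exact (contDiff_const.add hu).log (fun x => by have := h1 x; linarith)
  · exact (contDiff_const.sub hu).log (fun x => by have := h2 x; linarith)

lemma ga_pd {u : E2 → ℝ} (hu : ContDiff ℝ 2 u) {a : ℝ} (ha : 0 < a)
    (h1 : ∀ x, -a < u x) (h2 : ∀ x, u x < a) (i : Fin 2) (x : E2) :
    pd i (fun x => ga a (u x)) x = √2 / (a ^ 2 - u x ^ 2) * pd i u x :=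
  pd_comp (ga_hasDerivAt ha (h1 x) (h2 x)) (dat hu (by norm_num) x) i

lemma ga_lap {u : E2 → ℝ} (hu : IsACSolution u) {a : ℝ} (ha : 0 < a)
    (h1 : ∀ x, -a < u x) (h2 : ∀ x, u x < a) (x : E2) :
    pd 0 (pd 0 (fun x => ga a (u x))) x + pd 1 (pd 1 (fun x => ga a (u x))) x =
      √2 * u x * ((pd 0 (fun x => ga a (u x)) x) ^ 2 + (pd 1 (fun x => ga a (u x)) x) ^ 2
        - (1 - u x ^ 2) / (a ^ 2 - u x ^ 2)) := by
  obtain ⟨hC, heq⟩ := hu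
  have hE := heq x
  rw [laplacian_eq] at hE
  have p3 : a ^ 2 - u x ^ 2 ≠ 0 := by
    have e : a ^ 2 - u x ^ 2 = (a + u x) * (a - u x) := by ring
    have := h1 x; have := h2 x
    rw [e]; apply mul_ne_zero <;> linarith
  have key : ∀ i, pd i (pd i (fun x => ga a (u x))) x =
      √2 * (2 * u x) / (a ^ 2 - u x ^ 2) ^ 2 * pd i u x * pd i u x
      + √2 / (a ^ 2 - u x ^ 2) * pd i (pd i u) x := by
    intro i
    have e : pd i (fun x => ga a (u x)) = fun x => √2 / (a ^ 2 - u x ^ 2) * pd i u x :=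
      funext fun x => ga_pd hC ha h1 h2 i x
    have hd : HasDerivAt (fun s : ℝ => √2 / (a ^ 2 - s ^ 2))
        (√2 * (2 * u x) / (a ^ 2 - u x ^ 2) ^ 2) (u x) := by
      have := (((hasDerivAt_id' (u x)).fun_pow 2).const_sub (a ^ 2)).fun_inv p3
      have := this.const_mul (√2)
      simp only [div_eq_mul_inv]
      refine this.congr_deriv ?_
      field_simp
      ring
    have hdu : DifferentiableAt ℝ u x := dat hC (by norm_num) x
    have hdc : DifferentiableAt ℝ (fun x => √2 / (a ^ 2 - u x ^ 2)) x :=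
      hd.differentiableAt.comp x hdu
    rw [e, pd_mul hdc (dat (pd_contDiff1 hC i) (by norm_num) x),
      pd_comp (g := fun s : ℝ => √2 / (a ^ 2 - s ^ 2)) hd hdu]
  rw [key, key, ga_pd hC ha h1 h2, ga_pd hC ha h1 h2]
  have hL : pd 0 (pd 0 u) x + pd 1 (pd 1 u) x = u x ^ 3 - u x := by linarith
  have hL' : pd 1 (pd 1 u) x = u x ^ 3 - u x - pd 0 (pd 0 u) x := by linarith
  rw [hL']
  have h : (√2) ^ 2 = 2 := Real.sq_sqrt (by norm_num)
  field_simp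
  rw [h]
  ring

lemma exists_max_double {d : E2 → ℝ} (hd : Continuous d) {B K ε : ℝ} (hB : ∀ x, |d x| ≤ B)
    (hK : 1 < K) (hε : 0 < ε) (x0 y0 : E2)
    (h0 : 0 ≤ d x0 - d y0 - K * ‖x0 - y0‖ - ε * ‖x0‖ ^ 2) :
    ∃ x y : E2, ∀ x' y' : E2, d x' - d y' - K * ‖x' - y'‖ - ε * ‖x'‖ ^ 2
      ≤ d x - d y - K * ‖x - y‖ - ε * ‖x‖ ^ 2 := by
  set F : E2 × E2 → ℝ := fun p => d p.1 - d p.2 - K * ‖p.1 - p.2‖ - ε * ‖p.1‖ ^ 2 with hF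
  have hFc : Continuous F := by fun_prop
  have hBnn : 0 ≤ B := (abs_nonneg _).trans (hB x0)
  have hclosed : IsClosed {p | 0 ≤ F p} := isClosed_le continuous_const hFc
  have hsub : {p | 0 ≤ F p} ⊆
      Metric.closedBall (0 : E2) (1 + 2 * B / ε) ×ˢ Metric.closedBall (0 : E2) (1 + 2 * B / ε + 2 * B) := by
    rintro ⟨x, y⟩ hp
    simp only [mem_ofPred_eq, hF] at hp
    have b1 := abs_le.1 (hB x)
    have b2 := abs_le.1 (hB y)
    have n1 := norm_nonneg (x - y)
    have n2 := norm_nonneg x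
    have k1 : ε * ‖x‖ ^ 2 ≤ 2 * B := by nlinarith
    have k2 : ‖x - y‖ ≤ 2 * B := by nlinarith [mul_nonneg hε.le (sq_nonneg ‖x‖)]
    have k3 : ‖x‖ ^ 2 ≤ 2 * B / ε := by rw [le_div_iff₀ hε]; linarith
    have k4 : ‖x‖ ≤ 1 + 2 * B / ε := by nlinarith [sq_nonneg (‖x‖ - 1)]
    have k5 : ‖y‖ ≤ ‖x‖ + ‖x - y‖ := by
      have := norm_sub_le x (x - y)
      simpa using this
    simp only [mem_prod, mem_closedBall_zero_iff]
    exact ⟨k4, by linarith⟩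
  have hcomp : IsCompact {p | 0 ≤ F p} :=
    ((isCompact_closedBall _ _).prod (isCompact_closedBall _ _)).of_isClosed_subset hclosed hsub
  obtain ⟨⟨x, y⟩, hxy, hmax⟩ := hcomp.exists_isMaxOn ⟨(x0, y0), h0⟩ hFc.continuousOn
  refine ⟨x, y, fun x' y' => ?_⟩
  by_cases hp : 0 ≤ F (x', y')
  · exact hmax hp
  · exact (not_le.1 hp).le.trans hxy

lemma pd_norm_sub (x y : E2) (h : x ≠ y) (i : Fin 2) :
    pd i (fun z => ‖x - z‖) y = - (x i - y i) / ‖x - y‖ := by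
  have e : (fun z => ‖x - z‖) = fun z => √(nsq x z) := by
    funext z
    rw [nsq_eq, Real.sqrt_sq (norm_nonneg _), norm_sub_rev]
  have hpos : 0 < ‖x - y‖ := norm_pos_iff.2 (sub_ne_zero.2 h)
  have hn : nsq x y = ‖x - y‖ ^ 2 := by rw [nsq_eq, norm_sub_rev]
  have hne : nsq x y ≠ 0 := by rw [hn]; positivity
  rw [e, pd_comp (Real.hasDerivAt_sqrt hne) (dat (nsq_contDiff x (n := 1)) (by norm_num) y),
    pd_nsq, hn, Real.sqrt_sq hpos.le]
  field_simp
  ring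

lemma norm_sub_diff (x y : E2) (h : x ≠ y) : DifferentiableAt ℝ (fun z => ‖x - z‖) y := by
  have e : (fun z => ‖x - z‖) = fun z => √(nsq x z) := by
    funext z
    rw [nsq_eq, Real.sqrt_sq (norm_nonneg _), norm_sub_rev]
  have hpos : 0 < ‖x - y‖ := norm_pos_iff.2 (sub_ne_zero.2 h)
  have hn : nsq x y = ‖x - y‖ ^ 2 := by rw [nsq_eq, norm_sub_rev]
  have hne : nsq x y ≠ 0 := by rw [hn]; positivity
  rw [e]
  exact (dat (nsq_contDiff x (n := 1)) (by norm_num) y).sqrt hne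

/-- first and second order conditions at a maximum of the doubled function -/
lemma double_conditions {d : E2 → ℝ} (hd : ContDiff ℝ 2 d) {K ε : ℝ} (x y : E2) (hne : x ≠ y)
    (hmax : ∀ x' y' : E2, d x' - d y' - K * ‖x' - y'‖ - ε * ‖x'‖ ^ 2
      ≤ d x - d y - K * ‖x - y‖ - ε * ‖x‖ ^ 2) :
    ((pd 0 d y) ^ 2 + (pd 1 d y) ^ 2 = K ^ 2) ∧
    (∀ i, pd i d x = pd i d y + 2 * ε * x i) ∧
    (∀ i, pd i (pd i d) x - pd i (pd i d) y ≤ 2 * ε) := by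
  have hpos : 0 < ‖x - y‖ := norm_pos_iff.2 (sub_ne_zero.2 hne)
  have hdd : ∀ z, DifferentiableAt ℝ d z := dat hd (by norm_num)
  have c1 : ∀ i, pd i d y = K * (x i - y i) / ‖x - y‖ := by
    intro i
    have hl : IsLocalMax (fun z => - d z - K * ‖x - z‖) y := by
      refine Eventually.of_forall fun z => ?_
      have := hmax x z
      simp only
      linarith
    have := pd_eq_zero_of_max hl i
    have d1 := norm_sub_diff x y hne
    rw [pd_sub (hdd y).fun_neg (d1.const_mul K), pd_neg, pd_mul (by fun_prop) d1, pd_const,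
      pd_norm_sub x y hne] at this
    linear_combination -this
  set h := x - y with hh
  set G : E2 → ℝ := fun z => d z - d (z - h) - ε * nsq 0 z with hG
  have hGC : ContDiff ℝ 2 G := by
    have : ContDiff ℝ 2 (nsq 0) := nsq_contDiff 0
    have h2 : ContDiff ℝ 2 (fun z => d (z - h)) := hd.comp (contDiff_id.sub contDiff_const)
    exact (hd.sub h2).sub (contDiff_const.mul this)
  have hxh : x - h = y := by simp [hh]
  have hl : IsLocalMax G x := by
    refine Eventually.of_forall fun z => ?_
    have := hmax z (z - h)
    simp only [hG, nsq_eq, sub_zero, hxh]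
    have e : z - (z - h) = h := by abel
    rw [e] at this
    linarith
  have hpG : ∀ i, pd i G = fun z => pd i d z - pd i d (z - h) - ε * pd i (nsq 0) z := by
    intro i; funext z
    have d2 : DifferentiableAt ℝ (fun z => d (z - h)) z :=
      (hdd _).comp z (by fun_prop)
    have d3 : DifferentiableAt ℝ (nsq 0) z := dat (nsq_contDiff 0 (n := 1)) (by norm_num) z
    simp only [hG]
    rw [pd_sub ((hdd z).fun_sub d2) (d3.const_mul ε), pd_sub (hdd z) d2, pd_comp_sub,
      pd_mul (by fun_prop) d3, pd_const]
    ring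
  have hppG : ∀ i, pd i (pd i G) x = pd i (pd i d) x - pd i (pd i d) y - 2 * ε := by
    intro i
    have hdd' : ∀ z, DifferentiableAt ℝ (pd i d) z := dat (pd_contDiff1 hd i) (by norm_num)
    have d2 : DifferentiableAt ℝ (fun z => pd i d (z - h)) x :=
      (hdd' _).comp x (by fun_prop)
    have d3 : DifferentiableAt ℝ (pd i (nsq 0)) x :=
      dat (pd_contDiff1 (nsq_contDiff 0) i) (by norm_num) x
    rw [hpG, pd_sub ((hdd' x).fun_sub d2) (d3.const_mul ε), pd_sub (hdd' x) d2, pd_comp_sub,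
      pd_mul (by fun_prop) d3, pd_const, pdpd_nsq, hxh]
    ring
  refine ⟨?_, fun i => ?_, fun i => ?_⟩
  · rw [c1, c1]
    have hn : (x 0 - y 0) ^ 2 + (x 1 - y 1) ^ 2 = ‖h‖ ^ 2 := by
      rw [hh, ← nsq_eq]; rfl
    field_simp
    linear_combination K ^ 2 * hn
  · have := pd_eq_zero_of_max hl i
    rw [hpG] at this
    simp only [pd_nsq, hxh, PiLp.zero_apply] at this
    linarith
  · have := pdpd_nonpos_of_max hGC hl i
    rw [hppG] at this
    linarith

lemma ga_diff {a s t M : ℝ} (ha : 1 < a) (hs : s ≤ 1) (hs' : -1 ≤ s) (ht : -1 ≤ t) (ht' : t ≤ 1)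
    (hM : 0 < M) (h : M ≤ ga a s - ga a t) : M * a * (a - 1) / 2 ≤ s - t := by
  have hq : (1:ℝ) ≤ √2 := by
    rw [show (1:ℝ) = √1 by simp]; exact Real.sqrt_le_sqrt (by norm_num)
  have l1 : Real.log (a + s) - Real.log (a + t) ≤ (s - t) / (a + t) := by
    rw [← Real.log_div (by linarith) (by linarith)]
    refine (Real.log_le_sub_one_of_pos (div_pos (by linarith) (by linarith))).trans (le_of_eq ?_)
    have : a + t ≠ 0 := by linarith
    field_simp; ring
  have l2 : Real.log (a - t) - Real.log (a - s) ≤ (s - t) / (a - s) := by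
    rw [← Real.log_div (by linarith) (by linarith)]
    refine (Real.log_le_sub_one_of_pos (div_pos (by linarith) (by linarith))).trans (le_of_eq ?_)
    have : a - s ≠ 0 := by linarith
    field_simp; ring
  have h3 : M * (√2 * a) ≤ (s - t) / (a + t) + (s - t) / (a - s) := by
    have e : ga a s - ga a t = (√2 * a)⁻¹ *
      ((Real.log (a + s) - Real.log (a + t)) + (Real.log (a - t) - Real.log (a - s))) := by
      unfold ga; ring
    rw [e] at h
    have hp : 0 < √2 * a := by positivity
    have : M * (√2 * a) ≤
      ((Real.log (a + s) - Real.log (a + t)) + (Real.log (a - t) - Real.log (a - s))) := by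
      have := mul_le_mul_of_nonneg_right h hp.le
      refine this.trans (le_of_eq ?_)
      field_simp
    linarith
  have h4 : M * a ≤ M * (√2 * a) := by
    have : 0 ≤ M * a := by positivity
    nlinarith
  have hst : 0 ≤ s - t := by
    by_contra hneg; push Not at hneg
    have : (s - t) / (a + t) ≤ 0 := div_nonpos_of_nonpos_of_nonneg hneg.le (by linarith)
    have : (s - t) / (a - s) ≤ 0 := div_nonpos_of_nonpos_of_nonneg hneg.le (by linarith)
    have : 0 < M * a := by positivity
    linarith
  have h5 : (s - t) / (a + t) ≤ (s - t) / (a - 1) :=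
    div_le_div_of_nonneg_left hst (by linarith) (by linarith)
  have h6 : (s - t) / (a - s) ≤ (s - t) / (a - 1) :=
    div_le_div_of_nonneg_left hst (by linarith) (by linarith)
  have h7 : M * a ≤ 2 * (s - t) / (a - 1) := by
    have : 2 * (s - t) / (a - 1) = (s - t) / (a - 1) + (s - t) / (a - 1) := by ring
    linarith
  rw [le_div_iff₀ (by linarith)] at h7
  linarith

lemma q_mono {a s t : ℝ} (ha : 1 < a) (hs : s ≤ 1) (hs' : -1 ≤ s) (ht : -1 ≤ t) (ht' : t ≤ 1)
    (hst : t ≤ s) :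
    s * ((1 - s ^ 2) / (a ^ 2 - s ^ 2)) - t * ((1 - t ^ 2) / (a ^ 2 - t ^ 2)) ≤ s - t := by
  have p1 : 0 < a ^ 2 - s ^ 2 := by nlinarith
  have p2 : 0 < a ^ 2 - t ^ 2 := by nlinarith
  have e1 : s * ((1 - s ^ 2) / (a ^ 2 - s ^ 2)) = s - (a ^ 2 - 1) * (s / (a ^ 2 - s ^ 2)) := by
    field_simp; ring
  have e2 : t * ((1 - t ^ 2) / (a ^ 2 - t ^ 2)) = t - (a ^ 2 - 1) * (t / (a ^ 2 - t ^ 2)) := by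
    field_simp; ring
  have h : t / (a ^ 2 - t ^ 2) ≤ s / (a ^ 2 - s ^ 2) := by
    rw [div_le_div_iff₀ p2 p1]
    have : s * (a ^ 2 - t ^ 2) - t * (a ^ 2 - s ^ 2) = (s - t) * (a ^ 2 + s * t) := by ring
    have h2 : 0 ≤ a ^ 2 + s * t := by nlinarith
    nlinarith [mul_nonneg (sub_nonneg.2 hst) h2]
  have h3 : 0 ≤ a ^ 2 - 1 := by nlinarith
  rw [e1, e2]
  nlinarith [mul_le_mul_of_nonneg_left h h3]

lemma modica_alg {s t p0 p1 X Y x0 x1 n K θ m B : ℝ} (hs : |s| ≤ 1) (hK : 1 < K) (hθ : 0 < θ)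
    (hn : 0 ≤ n) (hxn : x0 ^ 2 + x1 ^ 2 = n ^ 2) (g : p0 ^ 2 + p1 ^ 2 = K ^ 2)
    (hB : (θ * n) ^ 2 ≤ 2 * B) (hm : m ≤ s - t) (hq : s * X - t * Y ≤ s - t)
    (hdiff : √2 * (s * ((p0 + 2 * θ ^ 2 * x0) ^ 2 + (p1 + 2 * θ ^ 2 * x1) ^ 2 - X)
        - t * (p0 ^ 2 + p1 ^ 2 - Y)) ≤ 4 * θ ^ 2) :
    (K ^ 2 - 1) * m ≤ 4 * θ ^ 2 + (4 * K * (1 + 2 * B) * θ) + 8 * B * θ ^ 2 := by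
  have hq2 : (1:ℝ) ≤ √2 := by
    rw [show (1:ℝ) = √1 by simp]; exact Real.sqrt_le_sqrt (by norm_num)
  have hB' : θ * n ≤ 1 + 2 * B := by nlinarith [sq_nonneg (θ * n - 1)]
  have cs : |p0 * x0 + p1 * x1| ≤ K * n := by
    apply abs_le_of_sq_le_sq _ (by positivity)
    rw [mul_pow, ← hxn, ← g]
    nlinarith [sq_nonneg (p0 * x1 - p1 * x0)]
  have hexp : (p0 + 2 * θ ^ 2 * x0) ^ 2 + (p1 + 2 * θ ^ 2 * x1) ^ 2
      = K ^ 2 + (4 * θ ^ 2 * (p0 * x0 + p1 * x1) + 4 * θ ^ 4 * n ^ 2) := by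
    rw [← hxn, ← g]; ring
  rw [hexp, g] at hdiff
  set W := 4 * θ ^ 2 * (p0 * x0 + p1 * x1) + 4 * θ ^ 4 * n ^ 2 with hWdef
  have t1 : |W| ≤ 4 * θ ^ 2 * (K * n) + 4 * θ ^ 4 * n ^ 2 := by
    refine (abs_add_le _ _).trans ?_
    rw [abs_mul, abs_of_nonneg (by positivity : 0 ≤ 4 * θ ^ 2),
      abs_of_nonneg (by positivity : 0 ≤ 4 * θ ^ 4 * n ^ 2)]
    gcongr
  have t2 : |W| ≤ 4 * K * (1 + 2 * B) * θ + 8 * B * θ ^ 2 := by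
    have e1 : 4 * θ ^ 2 * (K * n) = (4 * K * θ) * (θ * n) := by ring
    have e2 : 4 * θ ^ 4 * n ^ 2 = (4 * θ ^ 2) * (θ * n) ^ 2 := by ring
    have f1 : (4 * K * θ) * (θ * n) ≤ (4 * K * θ) * (1 + 2 * B) :=
      mul_le_mul_of_nonneg_left hB' (by positivity)
    have f2 : (4 * θ ^ 2) * (θ * n) ^ 2 ≤ (4 * θ ^ 2) * (2 * B) :=
      mul_le_mul_of_nonneg_left hB (by positivity)
    rw [e1, e2] at t1
    linarith
  have t3 : -|W| ≤ s * W := by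
    have : |s * W| ≤ |W| := by
      rw [abs_mul]; exact mul_le_of_le_one_left (abs_nonneg _) hs
    exact (abs_le.1 this).1
  have t4 : (K ^ 2 - 1) * m ≤ (K ^ 2 - 1) * (s - t) :=
    mul_le_mul_of_nonneg_left hm (by nlinarith)
  have t5 : (K ^ 2 - 1) * m - |W| ≤ s * (K ^ 2 + W - X) - t * (K ^ 2 - Y) := by
    have : s * (K ^ 2 + W - X) - t * (K ^ 2 - Y) = K ^ 2 * (s - t) + s * W - (s * X - t * Y) := by
      ring
    rw [this]
    linarith
  have t6 : s * (K ^ 2 + W - X) - t * (K ^ 2 - Y) ≤ 4 * θ ^ 2 := by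
    by_contra hneg
    push Not at hneg
    have : 0 < 4 * θ ^ 2 := by positivity
    nlinarith
  linarith

lemma modica_lip {u : E2 → ℝ} (hu : IsACSolution u) {a K : ℝ} (ha : 1 < a) (hK : 1 < K)
    (x0 y0 : E2) : ga a (u x0) - ga a (u y0) ≤ K * ‖x0 - y0‖ := by
  have u1 := u_le_one hu
  have u2 := neg_one_le_u hu
  have h1 : ∀ x, -a < u x := fun x => by have := u2 x; linarith
  have h2 : ∀ x, u x < a := fun x => by have := u1 x; linarith
  by_contra hcon
  push Not at hcon
  set d : E2 → ℝ := fun x => ga a (u x) with hd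
  have hdC : ContDiff ℝ 2 d := ga_contDiff hu.1 h1 h2
  set M := d x0 - d y0 - K * ‖x0 - y0‖ with hM
  have hMpos : 0 < M := by simp only [hM, hd]; linarith
  obtain ⟨B, hB⟩ : ∃ B, ∀ x, |d x| ≤ B := by
    refine ⟨(√2 * a)⁻¹ * (Real.log (a + 1) - Real.log (a - 1)), fun x => ?_⟩
    simp only [hd, ga]
    have hx1 := u1 x
    have hx2 := u2 x
    rw [abs_mul, abs_of_nonneg (by positivity)]
    refine mul_le_mul_of_nonneg_left ?_ (by positivity)
    have l1 : Real.log (a + u x) ≤ Real.log (a + 1) := Real.log_le_log (by linarith) (by linarith)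
    have l2 : Real.log (a - 1) ≤ Real.log (a + u x) := Real.log_le_log (by linarith) (by linarith)
    have l3 : Real.log (a - u x) ≤ Real.log (a + 1) := Real.log_le_log (by linarith) (by linarith)
    have l4 : Real.log (a - 1) ≤ Real.log (a - u x) := Real.log_le_log (by linarith) (by linarith)
    rw [abs_le]; constructor <;> linarith
  have hBnn : 0 ≤ B := (abs_nonneg _).trans (hB x0)
  set m := M / 2 * a * (a - 1) / 2 with hm
  have hmpos : 0 < m := by
    have : 0 < a - 1 := by linarith
    positivity
  have main : ∀ θ : ℝ, 0 < θ → θ ^ 2 * ‖x0‖ ^ 2 ≤ M / 2 →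
      (K ^ 2 - 1) * m ≤ 4 * θ ^ 2 + (4 * K * (1 + 2 * B) * θ) + 8 * B * θ ^ 2 := by
    intro θ hθ hθ0
    have hε : 0 < θ ^ 2 := by positivity
    have hF0 : M / 2 ≤ d x0 - d y0 - K * ‖x0 - y0‖ - θ ^ 2 * ‖x0‖ ^ 2 := by
      linarith
    obtain ⟨x, y, hmax⟩ := exists_max_double hdC.continuous hB hK hε x0 y0 (by linarith)
    have hval := hF0.trans (hmax x0 y0)
    have nn1 : 0 ≤ K * ‖x - y‖ := by positivity
    have nn2 : 0 ≤ θ ^ 2 * ‖x‖ ^ 2 := by positivity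
    have hdxy : M / 2 ≤ d x - d y := by linarith
    have hne : x ≠ y := by
      rintro rfl
      linarith
    obtain ⟨g, gx, sx⟩ := double_conditions hdC x y hne hmax
    have hst : m ≤ u x - u y :=
      ga_diff ha (u1 x) (u2 x) (u2 y) (u1 y) (by positivity) hdxy
    have hq := q_mono ha (u1 x) (u2 x) (u2 y) (u1 y) (by linarith : u y ≤ u x)
    have Lx := ga_lap hu (by linarith) h1 h2 x
    have Ly := ga_lap hu (by linarith) h1 h2 y
    have s0 := sx 0
    have s1 := sx 1
    have g0 := gx 0
    have g1 := gx 1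
    have hxn : x 0 ^ 2 + x 1 ^ 2 = ‖x‖ ^ 2 := by
      have := nsq_eq 0 x
      simpa [nsq] using this
    have hxle : (θ * ‖x‖) ^ 2 ≤ 2 * B := by
      have b1 := abs_le.1 (hB x)
      have b2 := abs_le.1 (hB y)
      have : (θ * ‖x‖) ^ 2 = θ ^ 2 * ‖x‖ ^ 2 := by ring
      linarith
    change pd 0 (pd 0 d) x + pd 1 (pd 1 d) x = √2 * u x * ((pd 0 d x) ^ 2 + (pd 1 d x) ^ 2 - _) at Lx
    change pd 0 (pd 0 d) y + pd 1 (pd 1 d) y = √2 * u y * ((pd 0 d y) ^ 2 + (pd 1 d y) ^ 2 - _) at Ly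
    rw [g0, g1] at Lx
    exact modica_alg (abs_le.2 ⟨u2 x, u1 x⟩) hK hθ (norm_nonneg x) hxn g hxle hst hq (by linarith)
  have hlim : Tendsto (fun θ : ℝ => 4 * θ ^ 2 + (4 * K * (1 + 2 * B) * θ) + 8 * B * θ ^ 2)
      (𝓝[>] 0) (𝓝 0) := by
    have : Continuous (fun θ : ℝ => 4 * θ ^ 2 + (4 * K * (1 + 2 * B) * θ) + 8 * B * θ ^ 2) := by
      fun_prop
    have := this.tendsto 0
    simp only [ne_eq, OfNat.ofNat_ne_zero, not_false_eq_true, zero_pow, mul_zero, add_zero] at this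
    exact this.mono_left nhdsWithin_le_nhds
  have hlim2 : Tendsto (fun θ : ℝ => θ ^ 2 * ‖x0‖ ^ 2) (𝓝[>] 0) (𝓝 0) := by
    have : Continuous (fun θ : ℝ => θ ^ 2 * ‖x0‖ ^ 2) := by fun_prop
    have := this.tendsto 0
    simp only [ne_eq, OfNat.ofNat_ne_zero, not_false_eq_true, zero_pow, zero_mul] at this
    exact this.mono_left nhdsWithin_le_nhds
  have hfin : (K ^ 2 - 1) * m ≤ 0 := by
    refine ge_of_tendsto hlim ?_
    filter_upwards [self_mem_nhdsWithin, hlim2.eventually (ge_mem_nhds (by positivity : 0 < M / 2))]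
      with θ h1 h2
    exact main θ h1 h2
  have : 0 < (K ^ 2 - 1) * m := mul_pos (by nlinarith) hmpos
  linarith

lemma grad_le_of_lip {d : E2 → ℝ} (hd : ∀ x y, d x - d y ≤ ‖x - y‖) (x : E2) :
    (pd 0 d x) ^ 2 + (pd 1 d x) ^ 2 ≤ 1 := by
  have hL : LipschitzWith 1 d := by
    refine LipschitzWith.of_le_add fun x y => ?_
    rw [dist_eq_norm]; linarith [hd x y]
  have hn : ‖fderiv ℝ d x‖ ≤ 1 := by simpa using norm_fderiv_le_of_lipschitz ℝ hL (x₀ := x)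
  set v : E2 := pd 0 d x • EuclideanSpace.single 0 (1:ℝ) + pd 1 d x • EuclideanSpace.single 1 (1:ℝ)
    with hv
  have e1 : fderiv ℝ d x v = (pd 0 d x) ^ 2 + (pd 1 d x) ^ 2 := by
    rw [hv, map_add, map_smul, map_smul]
    simp only [smul_eq_mul]
    change pd 0 d x * pd 0 d x + pd 1 d x * pd 1 d x = _
    ring
  have e2 : ‖v‖ ^ 2 = (pd 0 d x) ^ 2 + (pd 1 d x) ^ 2 := by
    rw [EuclideanSpace.norm_sq_eq]
    simp [hv, Fin.sum_univ_two]
  have e3 : fderiv ℝ d x v ≤ ‖v‖ := by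
    refine (le_abs_self _).trans ?_
    have := (fderiv ℝ d x).le_opNorm v
    rw [Real.norm_eq_abs] at this
    nlinarith [norm_nonneg v]
  rw [e1, ← e2] at e3
  rw [← e2]
  nlinarith [norm_nonneg v]

/-- Modica gradient estimate. -/
lemma modica {u : E2 → ℝ} (hu : IsACSolution u) (x : E2) :
    2 * ((pd 0 u x) ^ 2 + (pd 1 u x) ^ 2) ≤ (1 - u x ^ 2) ^ 2 := by
  have u1 := u_le_one hu
  have u2 := neg_one_le_u hu
  have key : ∀ a : ℝ, 1 < a →
      2 * ((pd 0 u x) ^ 2 + (pd 1 u x) ^ 2) ≤ (a ^ 2 - u x ^ 2) ^ 2 := by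
    intro a ha
    have h1 : ∀ x, -a < u x := fun x => by have := u2 x; linarith
    have h2 : ∀ x, u x < a := fun x => by have := u1 x; linarith
    have hl : ∀ x y, ga a (u x) - ga a (u y) ≤ ‖x - y‖ := by
      intro x y
      have hlim : Tendsto (fun K : ℝ => K * ‖x - y‖) (𝓝[>] 1) (𝓝 (1 * ‖x - y‖)) := by
        have : Continuous (fun K : ℝ => K * ‖x - y‖) := by fun_prop
        exact (this.tendsto 1).mono_left nhdsWithin_le_nhds
      rw [one_mul] at hlim
      refine ge_of_tendsto hlim ?_
      filter_upwards [self_mem_nhdsWithin] with K hK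
      exact modica_lip hu ha hK x y
    have := grad_le_of_lip (d := fun x => ga a (u x)) hl x
    rw [ga_pd hu.1 (by linarith) h1 h2, ga_pd hu.1 (by linarith) h1 h2] at this
    have p : 0 < a ^ 2 - u x ^ 2 := by nlinarith [u1 x, u2 x]
    have h : (√2) ^ 2 = 2 := Real.sq_sqrt (by norm_num)
    have e : (√2 / (a ^ 2 - u x ^ 2) * pd 0 u x) ^ 2 + (√2 / (a ^ 2 - u x ^ 2) * pd 1 u x) ^ 2
        = 2 * ((pd 0 u x) ^ 2 + (pd 1 u x) ^ 2) / (a ^ 2 - u x ^ 2) ^ 2 := by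
      field_simp
      rw [h]; ring
    rw [e, div_le_one (by positivity)] at this
    exact this
  have hlim : Tendsto (fun a : ℝ => (a ^ 2 - u x ^ 2) ^ 2) (𝓝[>] 1) (𝓝 ((1 ^ 2 - u x ^ 2) ^ 2)) := by
    have : Continuous (fun a : ℝ => (a ^ 2 - u x ^ 2) ^ 2) := by fun_prop
    exact (this.tendsto 1).mono_left nhdsWithin_le_nhds
  rw [one_pow] at hlim
  refine ge_of_tendsto hlim ?_
  filter_upwards [self_mem_nhdsWithin] with a ha using key a ha

lemma fderiv_apply_eq (f : E2 → ℝ) (z v : E2) :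
    fderiv ℝ f z v = v 0 * pd 0 f z + v 1 * pd 1 f z := by
  have hv : v = v 0 • EuclideanSpace.single 0 (1:ℝ) + v 1 • EuclideanSpace.single 1 (1:ℝ) := by
    ext i; fin_cases i <;> simp
  conv_lhs => rw [hv]
  rw [map_add, map_smul, map_smul]
  rfl

lemma u_lt_one {u : E2 → ℝ} (hu : IsACSolution u) (hnc : ¬ ∃ c : ℝ, ∀ x, u x = c) (x0 : E2) :
    u x0 < 1 := by
  refine lt_of_le_of_ne (u_le_one hu x0) fun h0 => hnc ⟨1, fun y => ?_⟩
  set v := y - x0 with hv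
  set f : ℝ → ℝ := fun t => 1 - u (x0 + t • v) with hf
  have hd : ∀ t, HasDerivAt f (- fderiv ℝ u (x0 + t • v) v) t := by
    intro t
    have h1 : HasDerivAt (fun s : ℝ => x0 + s • v) v t := by
      simpa using ((hasDerivAt_id t).smul_const v).const_add x0
    exact (((dat hu.1 (by norm_num) _).hasFDerivAt.comp_hasDerivAt t h1)).const_sub 1
  have hbound : ∀ t, ‖- fderiv ℝ u (x0 + t • v) v‖ ≤ (2 * ‖v‖) * ‖f t‖ := by
    intro t
    have hm := modica hu (x0 + t • v)
    have l1 := u_le_one hu (x0 + t • v)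
    have l2 := neg_one_le_u hu (x0 + t • v)
    have hfn : ‖f t‖ = 1 - u (x0 + t • v) := by
      rw [Real.norm_eq_abs, abs_of_nonneg]; simp only [hf]; linarith
    rw [hfn, norm_neg, Real.norm_eq_abs, fderiv_apply_eq]
    generalize pd 0 u (x0 + t • v) = p at *
    generalize pd 1 u (x0 + t • v) = q at *
    generalize u (x0 + t • v) = s at *
    have hvn : v 0 ^ 2 + v 1 ^ 2 = ‖v‖ ^ 2 := by
      have := nsq_eq 0 v
      simpa [nsq] using this
    have hs1 : 0 ≤ 1 - s := by linarith
    apply abs_le_of_sq_le_sq _ (by positivity)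
    have k1 : (v 0 * p + v 1 * q) ^ 2 ≤ ‖v‖ ^ 2 * (p ^ 2 + q ^ 2) := by
      rw [← hvn]; nlinarith [sq_nonneg (v 0 * q - v 1 * p)]
    have k2 : (1 - s ^ 2) ^ 2 ≤ 4 * (1 - s) ^ 2 := by
      have : (1 - s ^ 2) ^ 2 = (1 - s) ^ 2 * (1 + s) ^ 2 := by ring
      have h4 : (1 + s) ^ 2 ≤ 4 := by nlinarith
      rw [this]; nlinarith [sq_nonneg (1 - s)]
    have k3 : ‖v‖ ^ 2 * (p ^ 2 + q ^ 2) ≤ ‖v‖ ^ 2 * (4 * (1 - s) ^ 2) :=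
      mul_le_mul_of_nonneg_left (by nlinarith [sq_nonneg p, sq_nonneg q]) (by positivity)
    nlinarith
  have h1 : f 1 = 0 := by
    refine eq_zero_of_abs_deriv_le_mul_abs_self_of_eq_zero_right (f := f)
      (f' := fun t => - fderiv ℝ u (x0 + t • v) v) (K := 2 * ‖v‖) (a := 0) (b := 1) ?_ ?_ ?_ ?_ 1 (by simp)
    · exact fun t _ => (hd t).continuousAt.continuousWithinAt
    · exact fun t _ => (hd t).hasDerivWithinAt
    · simp [hf, h0]
    · exact fun t _ => hbound t
  simp only [hf, hv, one_smul, add_sub_cancel] at h1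
  linarith

lemma neg_one_lt_u {u : E2 → ℝ} (hu : IsACSolution u) (hnc : ¬ ∃ c : ℝ, ∀ x, u x = c) (x0 : E2) :
    -1 < u x0 := by
  have := u_lt_one (neg_sol hu) (fun ⟨c, hc⟩ => hnc ⟨-c, fun x => by have := hc x; linarith⟩) x0
  linarith

/-- the weight -/
noncomputable def wt (s : ℝ) : ℝ := (Real.cosh (s / (2 * √2)) ^ 4)⁻¹

lemma wt_pos (s : ℝ) : 0 < wt s := by
  have := Real.cosh_pos (s / (2 * √2))
  unfold wt; positivity

lemma wt_le_one (s : ℝ) : wt s ≤ 1 := by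
  unfold wt
  exact inv_le_one_of_one_le₀ (one_le_pow₀ (Real.one_le_cosh _))

lemma wt_contDiff {n : WithTop ℕ∞} : ContDiff ℝ n wt := by
  unfold wt
  refine ContDiff.inv ?_ (fun x => by have := Real.cosh_pos (x / (2 * √2)); positivity)
  exact (Real.contDiff_cosh.comp (contDiff_id.div_const _)).pow 4

lemma wt_hasDerivAt (s : ℝ) : HasDerivAt wt (-(√2 * H (s / 2)) * wt s) s := by
  have h1 : HasDerivAt (fun s : ℝ => s / (2 * √2)) (1 / (2 * √2)) s :=
    (hasDerivAt_id' s).div_const _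
  have hc := Real.cosh_pos (s / (2 * √2))
  have h2 := ((h1.cosh).fun_pow 4).fun_inv (by positivity)
  refine h2.congr_deriv ?_
  have e : s / 2 / √2 = s / (2 * √2) := by field_simp
  unfold H wt
  rw [e, Real.tanh_eq_sinh_div_cosh]
  have h : (√2) ^ 2 = 2 := Real.sq_sqrt (by norm_num)
  field_simp
  rw [h]; norm_num; ring

lemma H_strictMono : StrictMono H := by
  intro x y h
  unfold H
  rw [← Real.artanh_lt_artanh_iff ⟨Real.neg_one_lt_tanh _, Real.tanh_lt_one _⟩
    ⟨Real.neg_one_lt_tanh _, Real.tanh_lt_one _⟩, Real.artanh_tanh, Real.artanh_tanh]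
  exact div_lt_div_of_pos_right h (by positivity)

lemma H_ga {s : ℝ} (h1 : -1 < s) (h2 : s < 1) : H (ga 1 s) = s := by
  unfold H ga
  have h : (√2) * (√2) = 2 := Real.mul_self_sqrt (by norm_num)
  have e : (√2 * 1)⁻¹ * (Real.log (1 + s) - Real.log (1 - s)) / √2
      = 1/2 * Real.log ((1 + s) / (1 - s)) := by
    rw [Real.log_div (by linarith) (by linarith), mul_one, inv_mul_eq_div, div_div, h]; ring
  rw [e, ← Real.artanh_eq_half_log ⟨h1.le, h2.le⟩, Real.tanh_artanh ⟨h1, h2⟩]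

open MeasureTheory

/-- the integrable kernel -/
noncomputable def kern (ε : ℝ) (y : ℝ) : ℝ := (1 + y ^ 2) ^ (-1 - 2 * ε)

lemma ker_deriv {ε : ℝ} (hε : 0 < ε) (y : ℝ) :
    HasDerivAt (fun y : ℝ => -(4 * ε)⁻¹ * (1 + y ^ 2) ^ (-(2 * ε))) (y * kern ε y) y := by
  have h1 : HasDerivAt (fun y : ℝ => 1 + y ^ 2) (2 * y) y := by
    simpa using ((hasDerivAt_id' y).fun_pow 2).const_add 1
  have hp : 0 < 1 + y ^ 2 := by positivity
  have h2 := (h1.rpow_const (p := -(2 * ε)) (Or.inl hp.ne')).const_mul (-(4 * ε)⁻¹)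
  refine h2.congr_deriv ?_
  unfold kern
  rw [show -(2 * ε) - 1 = -1 - 2 * ε by ring]
  field_simp
  ring

lemma ker_tendsto {ε : ℝ} (hε : 0 < ε) :
    Tendsto (fun y : ℝ => -(4 * ε)⁻¹ * (1 + y ^ 2) ^ (-(2 * ε))) atTop (𝓝 0) := by
  have h1 : Tendsto (fun y : ℝ => 1 + y ^ 2) atTop atTop :=
    tendsto_atTop_add_const_left _ _ (tendsto_pow_atTop (by norm_num))
  have h2 := ((tendsto_rpow_neg_atTop (by positivity : 0 < 2 * ε)).comp h1).const_mul (-(4 * ε)⁻¹)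
  simpa using h2

lemma ker_integrable {ε : ℝ} (hε : 0 < ε) : Integrable (fun x : E2 => kern ε ‖x‖) := by
  rw [integrable_fun_norm_addHaar volume (f := kern ε)]
  have : Module.finrank ℝ E2 = 2 := by simp
  rw [this]
  have := integrableOn_Ioi_deriv_of_nonneg' (a := 0) (fun x _ => ker_deriv hε x)
    (fun x hx => mul_nonneg (le_of_lt hx) (by unfold kern; positivity)) (ker_tendsto hε)
  simpa using this

lemma ker_integral {ε : ℝ} (hε : 0 < ε) : ∫ x : E2, kern ε ‖x‖
    = 2 * (volume.real (Metric.ball (0 : E2) 1) * (4 * ε)⁻¹) := by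
  rw [integral_fun_norm_addHaar volume (kern ε)]
  have : Module.finrank ℝ E2 = 2 := by simp
  rw [this]
  have := integral_Ioi_of_hasDerivAt_of_nonneg' (a := 0) (fun x _ => ker_deriv hε x)
    (fun x hx => mul_nonneg (le_of_lt hx) (by unfold kern; positivity)) (ker_tendsto hε)
  simp only [Nat.add_one_sub_one, pow_one, smul_eq_mul, nsmul_eq_mul]
  rw [this]
  simp

/-- cutoff profile -/
noncomputable def gcut (ε : ℝ) (x : E2) : ℝ := (1 + nsq 0 x) ^ (-ε)

lemma nsq_nonneg (c x : E2) : 0 ≤ nsq c x := by unfold nsq; positivity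

lemma gcut_contDiff (ε : ℝ) : ContDiff ℝ 1 (gcut ε) := by
  unfold gcut
  exact (contDiff_const.add (nsq_contDiff 0)).rpow_const_of_ne
    (fun x => by have := nsq_nonneg 0 x; positivity)

lemma gcut_pd (ε : ℝ) (x : E2) (i : Fin 2) :
    pd i (gcut ε) x = -ε * (1 + nsq 0 x) ^ (-ε - 1) * (2 * x i) := by
  have hp : 0 < 1 + nsq 0 x := by have := nsq_nonneg 0 x; positivity
  have h1 : HasDerivAt (fun s : ℝ => (1 + s) ^ (-ε)) (-ε * (1 + nsq 0 x) ^ (-ε - 1)) (nsq 0 x) := by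
    have := ((hasDerivAt_id' (nsq 0 x)).const_add 1).rpow_const (p := -ε) (Or.inl hp.ne')
    simpa using this
  have := pd_comp h1 (dat (nsq_contDiff 0 (n := 1)) (by norm_num) x) i
  unfold gcut
  rw [this, pd_nsq]
  simp

lemma gcut_grad {ε : ℝ} (x : E2) :
    (pd 0 (gcut ε) x) ^ 2 + (pd 1 (gcut ε) x) ^ 2 ≤ 4 * ε ^ 2 * kern ε ‖x‖ := by
  rw [gcut_pd, gcut_pd]
  have hn : nsq 0 x = ‖x‖ ^ 2 := by rw [nsq_eq]; simp
  have hn' : x 0 ^ 2 + x 1 ^ 2 = ‖x‖ ^ 2 := by rw [← hn]; simp [nsq]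
  unfold kern
  rw [hn]
  have hp : 0 < 1 + ‖x‖ ^ 2 := by positivity
  have e : (1 + ‖x‖ ^ 2) ^ (-1 - 2 * ε) =
      ((1 + ‖x‖ ^ 2) ^ (-ε - 1)) ^ 2 * (1 + ‖x‖ ^ 2) := by
    generalize 1 + ‖x‖ ^ 2 = z at hp
    have e1 : (z ^ (-ε - 1)) ^ 2 = z ^ (-ε - 1 + (-ε - 1)) := by
      rw [Real.rpow_add hp, sq]
    rw [e1, ← Real.rpow_add_one hp.ne']
    congr 1
    ring
  rw [e]
  set A := (1 + ‖x‖ ^ 2) ^ (-ε - 1)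
  have : (-ε * A * (2 * x 0)) ^ 2 + (-ε * A * (2 * x 1)) ^ 2 = 4 * ε ^ 2 * (A ^ 2 * ‖x‖ ^ 2) := by
    rw [← hn']; ring
  rw [this]
  gcongr
  linarith

lemma sqpos_hasDerivAt (s : ℝ) : HasDerivAt (fun s : ℝ => (max s 0) ^ 2) (2 * max s 0) s := by
  rcases lt_trichotomy s 0 with h | h | h
  · rw [max_eq_right h.le]
    have : (fun s : ℝ => (max s 0) ^ 2) =ᶠ[𝓝 s] fun _ => 0 := by
      filter_upwards [Iio_mem_nhds h] with t ht
      rw [max_eq_right (le_of_lt ht)]; simp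
    rw [mul_zero]
    exact (hasDerivAt_const s (0:ℝ)).congr_of_eventuallyEq this
  · subst h
    rw [hasDerivAt_iff_tendsto_slope_zero]
    have h1 : Tendsto (fun t : ℝ => max t 0) (𝓝[≠] 0) (𝓝 (2 * max 0 0)) := by
      have : Continuous (fun t : ℝ => max t 0) := by fun_prop
      have := (this.tendsto 0).mono_left (nhdsWithin_le_nhds (s := {0}ᶜ))
      simpa using this
    refine h1.congr' ?_
    filter_upwards [self_mem_nhdsWithin] with t ht
    have ht' : t ≠ 0 := ht
    rcases le_total t 0 with h | h
    · simp [max_eq_right h]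
    · simp only [zero_add, max_eq_left h, max_self, smul_eq_mul]
      field_simp
      simp
  · rw [max_eq_left h.le]
    have : (fun s : ℝ => (max s 0) ^ 2) =ᶠ[𝓝 s] fun s => s ^ 2 := by
      filter_upwards [Ioi_mem_nhds h] with t ht
      rw [max_eq_left (le_of_lt ht)]
    have h2 : HasDerivAt (fun s : ℝ => s ^ 2) (2 * s) s := by
      simpa using (hasDerivAt_id' s).fun_pow 2
    exact h2.congr_of_eventuallyEq this

noncomputable def zcut (ε : ℝ) (x : E2) : ℝ := (max (gcut ε x - 1 / 4) 0) ^ 2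

lemma zcut_hd (ε : ℝ) (x : E2) : HasDerivAt (fun s : ℝ => (max (s - 1 / 4) 0) ^ 2)
    (2 * max (gcut ε x - 1 / 4) 0) (gcut ε x) := by
  have := (sqpos_hasDerivAt (gcut ε x - 1 / 4)).comp (gcut ε x)
    ((hasDerivAt_id' (gcut ε x)).sub_const (1 / 4))
  rw [mul_one] at this
  exact this

lemma zcut_pd (ε : ℝ) (x : E2) (i : Fin 2) :
    pd i (zcut ε) x = 2 * max (gcut ε x - 1 / 4) 0 * pd i (gcut ε) x :=
  pd_comp (zcut_hd ε x) (dat (gcut_contDiff ε) (by norm_num) x) i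

lemma zcut_diff (ε : ℝ) (x : E2) : DifferentiableAt ℝ (zcut ε) x :=
  (zcut_hd ε x).differentiableAt.comp x (dat (gcut_contDiff ε) (by norm_num) x)

lemma zcut_cont (ε : ℝ) : Continuous (zcut ε) :=
  continuous_iff_continuousAt.2 fun x => (zcut_diff ε x).continuousAt

lemma zcut_pd_cont (ε : ℝ) (i : Fin 2) : Continuous (pd i (zcut ε)) := by
  have e : pd i (zcut ε) = fun x => 2 * max (gcut ε x - 1 / 4) 0 * pd i (gcut ε) x :=
    funext fun x => zcut_pd ε x i
  have h1 := (gcut_contDiff ε).continuous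
  have h2 := pd_continuous (gcut_contDiff ε) i
  rw [e]; fun_prop

lemma gcut_compact {ε : ℝ} (hε : 0 < ε) : ∃ K : Set E2, IsCompact K ∧
    ∀ x, x ∉ K → max (gcut ε x - 1 / 4) 0 = 0 := by
  have h0 : Tendsto (fun x : E2 => 1 + ‖x‖ ^ 2) (cocompact E2) atTop :=
    tendsto_atTop_add_const_left _ _
      ((tendsto_pow_atTop (by norm_num)).comp (tendsto_norm_cocompact_atTop))
  have h1 := (tendsto_rpow_neg_atTop hε).comp h0
  have h2 : ∀ᶠ x in cocompact E2, gcut ε x < 1 / 4 := by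
    have := h1.eventually (gt_mem_nhds (by norm_num : (0:ℝ) < 1 / 4))
    filter_upwards [this] with x hx
    have hn : nsq 0 x = ‖x‖ ^ 2 := by rw [nsq_eq]; simp
    unfold gcut; rw [hn]; exact hx
  obtain ⟨K, hK, hs⟩ := mem_cocompact.1 h2
  refine ⟨K, hK, fun x hx => ?_⟩
  have : gcut ε x < 1 / 4 := hs hx
  exact max_eq_right (by linarith)

open MeasureTheory

noncomputable def Yf (D S : E2 → ℝ) (i : Fin 2) (x : E2) : ℝ :=
  wt (S x) * pd i D x * (D x)⁻¹

noncomputable def Qf (D S : E2 → ℝ) (x : E2) : ℝ :=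
  wt (S x) * ((pd 0 D x) ^ 2 + (pd 1 D x) ^ 2) * ((D x)⁻¹) ^ 2

lemma Yf_contDiff {D S : E2 → ℝ} (hD : ContDiff ℝ 2 D) (hS : ContDiff ℝ 2 S) (hpos : ∀ x, 0 < D x)
    (i : Fin 2) : ContDiff ℝ 1 (Yf D S i) := by
  have h1 : ContDiff ℝ 1 (fun x => wt (S x)) :=
    (wt_contDiff (n := 1)).comp (hS.of_le (by norm_num))
  have h2 := pd_contDiff1 hD i
  have h3 : ContDiff ℝ 1 (fun x => (D x)⁻¹) :=
    (hD.of_le (by norm_num)).inv (fun x => (hpos x).ne')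
  exact (h1.mul h2).mul h3

lemma Yf_pd {D S : E2 → ℝ} (hD : ContDiff ℝ 2 D) (hS : ContDiff ℝ 2 S) (hpos : ∀ x, 0 < D x)
    (i : Fin 2) (x : E2) : pd i (Yf D S i) x =
      wt (S x) * (D x)⁻¹ * (pd i (pd i D) x - √2 * H (S x / 2) * (pd i S x * pd i D x))
        - wt (S x) * (pd i D x) ^ 2 * ((D x)⁻¹) ^ 2 := by
  have dS : DifferentiableAt ℝ S x := dat hS (by norm_num) x
  have dD : DifferentiableAt ℝ D x := dat hD (by norm_num) x
  have hw : DifferentiableAt ℝ (fun x => wt (S x)) x :=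
    (wt_hasDerivAt (S x)).differentiableAt.comp x dS
  have hp : DifferentiableAt ℝ (pd i D) x := dat (pd_contDiff1 hD i) (by norm_num) x
  have hi : DifferentiableAt ℝ (fun x => (D x)⁻¹) x := dD.fun_inv (hpos x).ne'
  have e1 : pd i (fun x => wt (S x)) x = -(√2 * H (S x / 2)) * wt (S x) * pd i S x :=
    pd_comp (wt_hasDerivAt (S x)) dS i
  have e2 : pd i (fun x => (D x)⁻¹) x = -(D x ^ 2)⁻¹ * pd i D x :=
    pd_comp (hasDerivAt_inv (hpos x).ne') dD i
  unfold Yf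
  rw [pd_mul (hw.fun_mul hp) hi, pd_mul hw hp, e1, e2, inv_pow]
  ring

lemma Yf_div {D S : E2 → ℝ} (hD : ContDiff ℝ 2 D) (hS : ContDiff ℝ 2 S) (hpos : ∀ x, 0 < D x)
    (h : ∀ x, pd 0 (pd 0 D) x + pd 1 (pd 1 D) x
      - √2 * H (S x / 2) * (pd 0 S x * pd 0 D x + pd 1 S x * pd 1 D x) ≤ 0) (x : E2) :
    Qf D S x ≤ -(pd 0 (Yf D S 0) x + pd 1 (Yf D S 1) x) := by
  rw [Yf_pd hD hS hpos, Yf_pd hD hS hpos]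
  unfold Qf
  have hc : 0 < wt (S x) * (D x)⁻¹ := mul_pos (wt_pos _) (inv_pos.2 (hpos x))
  have := mul_nonpos_of_nonneg_of_nonpos hc.le (h x)
  linarith

lemma Qf_cont {D S : E2 → ℝ} (hD : ContDiff ℝ 2 D) (hS : ContDiff ℝ 2 S) (hpos : ∀ x, 0 < D x) :
    Continuous (Qf D S) := by
  have h1 : Continuous (fun x => wt (S x)) := (wt_contDiff (n := 1)).continuous.comp hS.continuous
  have h2 := (pd_contDiff1 hD 0).continuous
  have h3 := (pd_contDiff1 hD 1).continuous
  have h4 : Continuous (fun x => (D x)⁻¹) := hD.continuous.inv₀ (fun x => (hpos x).ne')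
  unfold Qf
  fun_prop

lemma Qf_nonneg (D S : E2 → ℝ) (x : E2) : 0 ≤ Qf D S x := by
  unfold Qf
  have := wt_pos (S x)
  positivity

lemma intg_of {ε : ℝ} (hε : 0 < ε) {f : E2 → ℝ} (hf : Continuous f)
    (h0 : ∀ x, max (gcut ε x - 1 / 4) 0 = 0 → f x = 0) : Integrable f := by
  obtain ⟨K, hK, hz⟩ := gcut_compact hε
  exact hf.integrable_of_hasCompactSupport
    (HasCompactSupport.intro hK (fun x hx => h0 x (hz x hx)))

lemma pointw (D S : E2 → ℝ) {ε : ℝ} (x : E2) :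
    pd 0 (zcut ε) x * Yf D S 0 x + pd 1 (zcut ε) x * Yf D S 1 x ≤
      1 / 2 * (zcut ε x * Qf D S x) + 8 * ε ^ 2 * kern ε ‖x‖ := by
  have hg := gcut_grad (ε := ε) x
  rw [zcut_pd, zcut_pd]
  unfold zcut Yf Qf
  set m := max (gcut ε x - 1 / 4) 0
  set a := pd 0 (gcut ε) x
  set b := pd 1 (gcut ε) x
  set p := pd 0 D x
  set q := pd 1 D x
  set r := (D x)⁻¹
  have hw := wt_pos (S x)
  have hw1 := wt_le_one (S x)
  set w := wt (S x)
  have h1 : w * (a ^ 2 + b ^ 2) ≤ a ^ 2 + b ^ 2 := by nlinarith [sq_nonneg a, sq_nonneg b]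
  have h2 : 0 ≤ w * ((m * p * r - 2 * a) ^ 2 + (m * q * r - 2 * b) ^ 2) := by positivity
  nlinarith

lemma energy {D S : E2 → ℝ} (hD : ContDiff ℝ 2 D) (hS : ContDiff ℝ 2 S) (hpos : ∀ x, 0 < D x)
    (h : ∀ x, pd 0 (pd 0 D) x + pd 1 (pd 1 D) x
      - √2 * H (S x / 2) * (pd 0 S x * pd 0 D x + pd 1 S x * pd 1 D x) ≤ 0)
    {ε : ℝ} (hε : 0 < ε) : Integrable (fun x => zcut ε x * Qf D S x) ∧
    ∫ x, zcut ε x * Qf D S x ≤ 8 * volume.real (Metric.ball (0 : E2) 1) * ε := by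
  have zc := zcut_cont ε
  have zpc := zcut_pd_cont ε
  have Yc : ∀ i, Continuous (Yf D S i) := fun i => (Yf_contDiff hD hS hpos i).continuous
  have Ypc : ∀ i, Continuous (pd i (Yf D S i)) := fun i => pd_continuous (Yf_contDiff hD hS hpos i) i
  have z0 : ∀ x, max (gcut ε x - 1 / 4) 0 = 0 → zcut ε x = 0 := fun x hx => by
    unfold zcut; rw [hx]; norm_num
  have zp0 : ∀ i x, max (gcut ε x - 1 / 4) 0 = 0 → pd i (zcut ε) x = 0 := fun i x hx => by
    rw [zcut_pd, hx]; ring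
  have I1 : Integrable (fun x => zcut ε x * Qf D S x) :=
    intg_of hε (zc.mul (Qf_cont hD hS hpos)) (fun x hx => by rw [z0 x hx, zero_mul])
  have I2 : ∀ i, Integrable (fun x => zcut ε x * pd i (Yf D S i) x) := fun i =>
    intg_of hε (zc.mul (Ypc i)) (fun x hx => by rw [z0 x hx, zero_mul])
  have I3 : ∀ i, Integrable (fun x => pd i (zcut ε) x * Yf D S i x) := fun i =>
    intg_of hε ((zpc i).mul (Yc i)) (fun x hx => by rw [zp0 i x hx, zero_mul])
  have I4 : ∀ i, Integrable (fun x => zcut ε x * Yf D S i x) := fun i =>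
    intg_of hε (zc.mul (Yc i)) (fun x hx => by rw [z0 x hx, zero_mul])
  have ibp : ∀ i, ∫ x, zcut ε x * pd i (Yf D S i) x = - ∫ x, pd i (zcut ε) x * Yf D S i x :=
    fun i => integral_mul_fderiv_eq_neg_fderiv_mul_of_integrable (μ := volume)
      (f := zcut ε) (g := Yf D S i) (v := EuclideanSpace.single i 1) (I3 i) (I2 i) (I4 i)
      (fun x _ => zcut_diff ε x) (fun x _ => dat (Yf_contDiff hD hS hpos i) (by norm_num) x)
  refine ⟨I1, ?_⟩
  have s1 : ∫ x, zcut ε x * Qf D S x ≤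
      ∫ x, (-(zcut ε x * pd 0 (Yf D S 0) x) - zcut ε x * pd 1 (Yf D S 1) x) := by
    refine integral_mono I1 ((I2 0).neg.sub (I2 1)) (fun x => ?_)
    have := mul_le_mul_of_nonneg_left (Yf_div hD hS hpos h x)
      (show 0 ≤ zcut ε x by unfold zcut; positivity)
    simp only
    linarith
  rw [integral_sub (f := fun x => -(zcut ε x * pd 0 (Yf D S 0) x)) (I2 0).neg (I2 1), integral_neg, ibp 0, ibp 1] at s1
  have s2 : ∫ x, (pd 0 (zcut ε) x * Yf D S 0 x + pd 1 (zcut ε) x * Yf D S 1 x) ≤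
      ∫ x, (1 / 2 * (zcut ε x * Qf D S x) + 8 * ε ^ 2 * kern ε ‖x‖) :=
    integral_mono ((I3 0).add (I3 1)) ((I1.const_mul _).add ((ker_integrable hε).const_mul _))
      (fun x => pointw D S x)
  rw [integral_add (I3 0) (I3 1), integral_add (I1.const_mul _) ((ker_integrable hε).const_mul _),
    integral_const_mul, integral_const_mul, ker_integral hε] at s2
  have e : 8 * ε ^ 2 * (2 * (volume.real (Metric.ball (0 : E2) 1) * (4 * ε)⁻¹))
      = 4 * volume.real (Metric.ball (0 : E2) 1) * ε := by field_simp; ring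
  rw [e] at s2
  linarith

lemma Qf_zero {D S : E2 → ℝ} (hD : ContDiff ℝ 2 D) (hS : ContDiff ℝ 2 S) (hpos : ∀ x, 0 < D x)
    (h : ∀ x, pd 0 (pd 0 D) x + pd 1 (pd 1 D) x
      - √2 * H (S x / 2) * (pd 0 S x * pd 0 D x + pd 1 S x * pd 1 D x) ≤ 0) (x₀ : E2) :
    Qf D S x₀ = 0 := by
  by_contra hne
  have hq : 0 < Qf D S x₀ := lt_of_le_of_ne (Qf_nonneg D S x₀) (Ne.symm hne)
  have hev : ∀ᶠ x in 𝓝 x₀, Qf D S x₀ / 2 < Qf D S x :=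
    (Qf_cont hD hS hpos).continuousAt.eventually (lt_mem_nhds (by linarith))
  obtain ⟨ρ, hρ, hball⟩ := Metric.eventually_nhds_iff_ball.1 hev
  set c := Qf D S x₀ / 2 with hc
  set R : ℝ := ‖x₀‖ + ρ
  have hlim : Tendsto (fun ε : ℝ => (1 + R ^ 2) ^ (-ε)) (𝓝[>] 0) (𝓝 1) := by
    have h1 : Continuous (fun ε : ℝ => (1 + R ^ 2) ^ (-ε)) :=
      Continuous.rpow continuous_const continuous_neg (fun x => Or.inl (by positivity))
    have := (h1.tendsto 0).mono_left (nhdsWithin_le_nhds (s := Ioi 0))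
    simpa using this
  have hev2 : ∀ᶠ ε in 𝓝[>] (0:ℝ), 1 / 2 < (1 + R ^ 2) ^ (-ε) :=
    hlim.eventually (lt_mem_nhds (by norm_num))
  set V := volume.real (Metric.ball x₀ ρ)
  have hV : 0 < V := ENNReal.toReal_pos (Metric.measure_ball_pos volume x₀ hρ).ne'
    measure_ball_lt_top.ne
  set B := volume.real (Metric.ball (0 : E2) 1)
  have hkey : ∀ᶠ ε in 𝓝[>] (0:ℝ), c / 16 * V ≤ 8 * B * ε := by
    filter_upwards [hev2, self_mem_nhdsWithin] with ε he hε
    have hε : 0 < ε := hε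
    obtain ⟨I, hI⟩ := energy hD hS hpos h hε
    refine le_trans ?_ hI
    have nn : ∀ x, 0 ≤ zcut ε x * Qf D S x := fun x =>
      mul_nonneg (by unfold zcut; positivity) (Qf_nonneg D S x)
    refine le_trans ?_ (setIntegral_le_integral (s := Metric.ball x₀ ρ) I (Eventually.of_forall nn))
    refine setIntegral_ge_of_const_le_real measurableSet_ball measure_ball_lt_top.ne ?_ I.integrableOn
    intro x hx
    have hb := hball x hx
    have hn : nsq 0 x = ‖x‖ ^ 2 := by rw [nsq_eq]; simp
    have hxR : ‖x‖ ≤ R := by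
      have : ‖x - x₀‖ < ρ := by simpa [dist_eq_norm] using hx
      have := norm_le_norm_add_norm_sub' x x₀
      simp only [R]; linarith
    have hg : 1 / 2 < gcut ε x := by
      refine he.trans_le ?_
      unfold gcut
      rw [hn]
      exact Real.rpow_le_rpow_of_nonpos (by positivity) (by gcongr) (by linarith)
    have hz : 1 / 16 ≤ zcut ε x := by
      unfold zcut
      rw [max_eq_left (by linarith)]
      nlinarith
    have : 0 < c := by rw [hc]; linarith
    calc c / 16 = 1 / 16 * c := by ring
      _ ≤ zcut ε x * Qf D S x := by gcongr
  have hl2 : Tendsto (fun ε : ℝ => 8 * B * ε) (𝓝[>] 0) (𝓝 0) := by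
    have h1 : Continuous (fun ε : ℝ => 8 * B * ε) := by fun_prop
    have := (h1.tendsto 0).mono_left (nhdsWithin_le_nhds (s := Ioi 0))
    simpa using this
  have := ge_of_tendsto hl2 hkey
  have : 0 < c / 16 * V := by positivity
  linarith

lemma parabolic {D S : E2 → ℝ} (hD : ContDiff ℝ 2 D) (hS : ContDiff ℝ 2 S) (hpos : ∀ x, 0 < D x)
    (h : ∀ x, pd 0 (pd 0 D) x + pd 1 (pd 1 D) x
      - √2 * H (S x / 2) * (pd 0 S x * pd 0 D x + pd 1 S x * pd 1 D x) ≤ 0) (x : E2) :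
    pd 0 D x = 0 ∧ pd 1 D x = 0 := by
  have := Qf_zero hD hS hpos h x
  unfold Qf at this
  have hw := (wt_pos (S x)).ne'
  have hd := (hpos x).ne'
  have h2 : (pd 0 D x) ^ 2 + (pd 1 D x) ^ 2 = 0 := by
    rcases mul_eq_zero.1 this with h | h
    · exact (mul_eq_zero.1 h).resolve_left hw
    · exact absurd h (by positivity)
  constructor <;> nlinarith [sq_nonneg (pd 0 D x), sq_nonneg (pd 1 D x)]

lemma const_of_pd {f : E2 → ℝ} (hf : Differentiable ℝ f) (h0 : ∀ x, pd 0 f x = 0)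
    (h1 : ∀ x, pd 1 f x = 0) (x y : E2) : f x = f y :=
  is_const_of_fderiv_eq_zero hf (fun z => by ext v; rw [fderiv_apply_eq, h0, h1]; simp) x y

lemma pd_symm {f : E2 → ℝ} (hf : ContDiff ℝ 2 f) (x : E2) :
    pd 0 (pd 1 f) x = pd 1 (pd 0 f) x := by
  have hs : IsSymmSndFDerivAt ℝ f x := hf.contDiffAt.isSymmSndFDerivAt (by simp)
  have hd : DifferentiableAt ℝ (fderiv ℝ f) x :=
    ((hf.fderiv_right (m := 1) (by norm_num [one_add_one_eq_two])).differentiable (by norm_num)) x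
  have key : ∀ v w : E2, fderiv ℝ (fun y => fderiv ℝ f y v) x w = fderiv ℝ (fderiv ℝ f) x w v := by
    intro v w
    rw [fderiv_clm_apply hd (differentiableAt_const v)]
    simp
  unfold pd
  rw [key, key]
  exact hs _ _

lemma main_thm (u₁ u₂ : E2 → ℝ)
    (hu₁ : IsACSolution u₁) (hu₂ : IsACSolution u₂)
    (hnc₁ : ¬ ∃ c : ℝ, ∀ x, u₁ x = c) (hnc₂ : ¬ ∃ c : ℝ, ∀ x, u₂ x = c)
    (hlt : ∀ x, u₁ x < u₂ x) :
    ∃ e : EuclideanSpace ℝ (Fin 2), ‖e‖ = 1 ∧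
      ∃ a b : ℝ, a < b ∧
        (∀ x, u₁ x = H (⟪x, e⟫ + a)) ∧ (∀ x, u₂ x = H (⟪x, e⟫ + b)) := by
  have one : (0:ℝ) < 1 := one_pos
  have l1 := neg_one_lt_u hu₁ hnc₁
  have r1 := u_lt_one hu₁ hnc₁
  have l2 := neg_one_lt_u hu₂ hnc₂
  have r2 := u_lt_one hu₂ hnc₂
  have gen : ∀ u : E2 → ℝ, IsACSolution u → (∀ x, -1 < u x) → (∀ x, u x < 1) →
      ∃ d : E2 → ℝ, ContDiff ℝ 2 d ∧ (∀ x, H (d x) = u x) ∧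
        (∀ x, (pd 0 d x) ^ 2 + (pd 1 d x) ^ 2 ≤ 1) ∧
        (∀ x, pd 0 (pd 0 d) x + pd 1 (pd 1 d) x
          = √2 * u x * ((pd 0 d x) ^ 2 + (pd 1 d x) ^ 2 - 1)) := by
    intro u hu l r
    refine ⟨fun x => ga 1 (u x), ga_contDiff hu.1 l r, fun x => H_ga (l x) (r x), ?_, ?_⟩
    · intro x
      rw [ga_pd hu.1 one l r, ga_pd hu.1 one l r]
      have hm := modica hu x
      have hp : 0 < 1 - u x ^ 2 := by nlinarith [l x, r x]
      have h2 : (√2) ^ 2 = 2 := Real.sq_sqrt (by norm_num)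
      have e : (√2 / (1 ^ 2 - u x ^ 2) * pd 0 u x) ^ 2 + (√2 / (1 ^ 2 - u x ^ 2) * pd 1 u x) ^ 2
          = 2 * ((pd 0 u x) ^ 2 + (pd 1 u x) ^ 2) / (1 - u x ^ 2) ^ 2 := by
        rw [mul_pow, mul_pow, div_pow, h2, one_pow]; ring
      rw [e, div_le_one (by positivity)]
      exact hm
    · intro x
      rw [ga_lap hu one l r x]
      have hp : 0 < 1 - u x ^ 2 := by nlinarith [l x, r x]
      rw [one_pow, div_self hp.ne']
  obtain ⟨d₁, c1, H1, g1, lap1⟩ := gen u₁ hu₁ l1 r1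
  obtain ⟨d₂, c2, H2, g2, lap2⟩ := gen u₂ hu₂ l2 r2
  have dd1 : ∀ x, DifferentiableAt ℝ d₁ x := fun x => dat c1 (by norm_num) x
  have dd2 : ∀ x, DifferentiableAt ℝ d₂ x := fun x => dat c2 (by norm_num) x
  have dp1 : ∀ i x, DifferentiableAt ℝ (pd i d₁) x :=
    fun i x => dat (pd_contDiff1 c1 i) (by norm_num) x
  have dp2 : ∀ i x, DifferentiableAt ℝ (pd i d₂) x :=
    fun i x => dat (pd_contDiff1 c2 i) (by norm_num) x
  have hdlt : ∀ x, d₁ x < d₂ x := fun x => H_strictMono.lt_iff_lt.1 (by rw [H1, H2]; exact hlt x)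
  have pD : ∀ i, pd i (fun x => d₂ x - d₁ x) = fun x => pd i d₂ x - pd i d₁ x :=
    fun i => funext fun x => pd_sub (dd2 x) (dd1 x) i
  have pS : ∀ i x, pd i (fun x => d₁ x + d₂ x) x = pd i d₁ x + pd i d₂ x :=
    fun i x => pd_add (dd1 x) (dd2 x) i
  have ppD : ∀ i x, pd i (fun x => pd i d₂ x - pd i d₁ x) x = pd i (pd i d₂) x - pd i (pd i d₁) x :=
    fun i x => pd_sub (dp2 i x) (dp1 i x) i
  have s2 : 0 < √2 := by positivity
  have par := parabolic (D := fun x => d₂ x - d₁ x) (S := fun x => d₁ x + d₂ x)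
    (c2.sub c1) (c1.add c2) (fun x => sub_pos.2 (hdlt x)) (by
      intro x
      rw [pD, pD, ppD, ppD, pS, pS]
      have hh1 : u₁ x < H ((d₁ x + d₂ x) / 2) := by
        rw [← H1]; exact H_strictMono (by linarith [hdlt x])
      have hh2 : H ((d₁ x + d₂ x) / 2) < u₂ x := by
        rw [← H2]; exact H_strictMono (by linarith [hdlt x])
      set h := H ((d₁ x + d₂ x) / 2)
      have e1 := lap1 x
      have e2 := lap2 x
      have t1 := mul_nonneg s2.le (mul_nonneg (sub_pos.2 hh1).le (sub_nonneg.2 (g1 x)))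
      have t2 := mul_nonneg s2.le (mul_nonneg (sub_pos.2 hh2).le (sub_nonneg.2 (g2 x)))
      simp only
      linear_combination e2 - e1 + t1 + t2)
  rw [pD, pD] at par
  have q0 : ∀ x, pd 0 d₂ x = pd 0 d₁ x := fun x => sub_eq_zero.1 (par x).1
  have q1 : ∀ x, pd 1 d₂ x = pd 1 d₁ x := fun x => sub_eq_zero.1 (par x).2
  have unit : ∀ x, (pd 0 d₁ x) ^ 2 + (pd 1 d₁ x) ^ 2 = 1 := by
    intro x
    have e1 := lap1 x
    have e2 := lap2 x
    rw [funext q0, funext q1, e1] at e2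
    have : √2 * (u₂ x - u₁ x) * ((pd 0 d₁ x) ^ 2 + (pd 1 d₁ x) ^ 2 - 1) = 0 := by
      linear_combination -e2
    have hne : √2 * (u₂ x - u₁ x) ≠ 0 := (mul_pos s2 (sub_pos.2 (hlt x))).ne'
    linarith [(mul_eq_zero.1 this).resolve_left hne]
  have lap0 : ∀ x, pd 0 (pd 0 d₁) x + pd 1 (pd 1 d₁) x = 0 := by
    intro x; rw [lap1, unit]; ring
  have der : ∀ i x, pd 0 d₁ x * pd i (pd 0 d₁) x + pd 1 d₁ x * pd i (pd 1 d₁) x = 0 := by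
    intro i x
    have e : (fun x => pd 0 d₁ x * pd 0 d₁ x + pd 1 d₁ x * pd 1 d₁ x) = fun _ => (1:ℝ) := by
      funext x; have := unit x; linarith
    have h := pd_const 1 x i
    rw [← e, pd_add ((dp1 0 x).fun_mul (dp1 0 x)) ((dp1 1 x).fun_mul (dp1 1 x)),
      pd_mul (dp1 0 x) (dp1 0 x), pd_mul (dp1 1 x) (dp1 1 x)] at h
    linarith
  have hess : ∀ x, pd 0 (pd 0 d₁) x = 0 ∧ pd 1 (pd 0 d₁) x = 0 ∧ pd 0 (pd 1 d₁) x = 0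
      ∧ pd 1 (pd 1 d₁) x = 0 := by
    intro x
    have a1 := der 0 x
    have a2 := der 1 x
    have a3 := lap0 x
    have a4 := pd_symm c1 x
    have a5 := unit x
    rw [a4] at a1 ⊢
    set p := pd 0 d₁ x
    set q := pd 1 d₁ x
    set A := pd 0 (pd 0 d₁) x
    set B := pd 1 (pd 0 d₁) x
    have e : pd 1 (pd 1 d₁) x = -A := by linarith
    rw [e] at a2 ⊢
    have hA : A = 0 := by
      linear_combination (-A) * a5 + p * a1 - q * a2
    have hB : B = 0 := by
      linear_combination (-B) * a5 + q * a1 + p * a2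
    rw [hA, hB]; simp
  have cst : ∀ i x, pd i d₁ x = pd i d₁ 0 := by
    intro i x
    refine const_of_pd (fun x => dp1 i x) ?_ ?_ x 0
    · intro x; fin_cases i
      · exact (hess x).1
      · exact (hess x).2.2.1
    · intro x; fin_cases i
      · exact (hess x).2.1
      · exact (hess x).2.2.2
  set p := pd 0 d₁ 0 with hp
  set q := pd 1 d₁ 0 with hq
  have lin : ∀ x, d₁ x = (p * x 0 + q * x 1) + d₁ 0 := by
    intro x
    have hc : ∀ x : E2, DifferentiableAt ℝ (fun y : E2 => p * y 0 + q * y 1) x := fun x => by fun_prop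
    have hpd : ∀ i x, pd i (fun y : E2 => p * y 0 + q * y 1) x
        = p * (if (0:Fin 2) = i then 1 else 0) + q * (if (1:Fin 2) = i then 1 else 0) := by
      intro i x
      have h0 : ∀ j : Fin 2, DifferentiableAt ℝ (fun y : E2 => y j) x := fun j => by fun_prop
      rw [pd_add ((differentiableAt_const p).fun_mul (h0 0)) ((differentiableAt_const q).fun_mul (h0 1)),
        pd_mul (differentiableAt_const p) (h0 0), pd_mul (differentiableAt_const q) (h0 1),
        pd_const, pd_const, pd_coord, pd_coord]
      ring
    have := const_of_pd (f := fun y => d₁ y - (p * y 0 + q * y 1)) (fun y => (dd1 y).fun_sub (hc y))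
      (fun y => by rw [pd_sub (dd1 y) (hc y), hpd, cst]; simp [hp])
      (fun y => by rw [pd_sub (dd1 y) (hc y), hpd, cst]; simp [hq]) x 0
    simp at this
    linarith
  have dif : ∀ x, d₂ x = d₁ x + (d₂ 0 - d₁ 0) := by
    intro x
    have := const_of_pd (f := fun y => d₂ y - d₁ y) (fun y => (dd2 y).fun_sub (dd1 y))
      (fun y => by rw [pD]; simp [q0]) (fun y => by rw [pD]; simp [q1]) x 0
    linarith
  refine ⟨!₂[p, q], ?_, d₁ 0, d₂ 0, hdlt 0, fun x => ?_, fun x => ?_⟩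
  · rw [EuclideanSpace.norm_eq]
    simp [Fin.sum_univ_two, unit 0, hp, hq]
  · rw [← H1, lin x]
    congr 2
    simp [PiLp.inner_apply, Fin.sum_univ_two]
  · rw [← H2, dif x, lin x]
    have : ⟪x, !₂[p, q]⟫ = p * x 0 + q * x 1 := by
      simp [PiLp.inner_apply, Fin.sum_univ_two]
    rw [this]
    congr 1
    ring

theorem strong_half_space (u₁ u₂ : EuclideanSpace ℝ (Fin 2) → ℝ)
    (hu₁ : IsACSolution u₁) (hu₂ : IsACSolution u₂)
    (hnc₁ : ¬ ∃ c : ℝ, ∀ x, u₁ x = c) (hnc₂ : ¬ ∃ c : ℝ, ∀ x, u₂ x = c)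
    (hlt : ∀ x, u₁ x < u₂ x) :
    ∃ e : EuclideanSpace ℝ (Fin 2), ‖e‖ = 1 ∧
      ∃ a b : ℝ, a < b ∧
        (∀ x, u₁ x = H (⟪x, e⟫ + a)) ∧ (∀ x, u₂ x = H (⟪x, e⟫ + b)) := by
  exact main_thm u₁ u₂ hu₁ hu₂ hnc₁ hnc₂ hlt
end
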